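/- arXiv:2505.06169 — 6 statements merged into one kernel-verified Lean document; each statement's English description precedes it below -/
import Mathlib

section
/- For every natural number k, the maximum function MAX_2(x) = max{x_1, x_2} on ℝ² is not in ReLU⁺_{2,k}; that is, MAX_2 is not computable by any monotone ReLU network, regardless of depth. -/
noncomputable section

/-- The rectified linear unit. -/
def relu (t : ℝ) : ℝ := max 0 t

/-- `ReLUplus n k F` : `F : ℝⁿ → ℝ` is computable by a depth-`k` monotone ReLU network. -/
inductive ReLUplus (n : ℕ) : ℕ → ((Fin n → ℝ) → ℝ) → Prop
  | affine (a : Fin n → ℝ) (b : ℝ) (ha : ∀ i, 0 ≤ a i) :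
      ReLUplus n 0 (fun x => (∑ i, a i * x i) + b)
  | comb {k : ℕ} {F G : (Fin n → ℝ) → ℝ} (c c' b : ℝ) (hc : 0 ≤ c) (hc' : 0 ≤ c')
      (hF : ReLUplus n k F) (hG : ReLUplus n k G) :
      ReLUplus n k (fun x => c * F x + c' * G x + b)
  | act {k : ℕ} {F : (Fin n → ℝ) → ℝ} (hF : ReLUplus n k F) :
      ReLUplus n (k + 1) (fun x => relu (F x))
  | deepen {k : ℕ} {F : (Fin n → ℝ) → ℝ} (hF : ReLUplus n k F) :
      ReLUplus n (k + 1) F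

/-- `relu` preserves increasing differences of values ordered as in a monotone square. -/
theorem relu_sub_relu_le {a b c d : ℝ} (hab : a ≤ b) (hac : a ≤ c) (hbd : b ≤ d) (hcd : c ≤ d)
    (h : b - a ≤ d - c) : relu b - relu a ≤ relu d - relu c := by
  unfold relu
  rcases max_cases 0 a with ha | ha <;> rcases max_cases 0 b with hb | hb <;>
    rcases max_cases 0 c with hc | hc <;> rcases max_cases 0 d with hd | hd <;> linarith

theorem ReLUplus.monotone {n k : ℕ} {F : (Fin n → ℝ) → ℝ} (hF : ReLUplus n k F) :
    Monotone F := by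
  induction hF with
  | affine a b ha =>
    intro x y hxy
    have := Finset.sum_le_sum fun i (_ : i ∈ Finset.univ) =>
      mul_le_mul_of_nonneg_left (hxy i) (ha i)
    simpa using this
  | comb c c' b hc hc' _ _ ihF ihG =>
    intro x y hxy
    have h₁ := mul_le_mul_of_nonneg_left (ihF hxy) hc
    have h₂ := mul_le_mul_of_nonneg_left (ihG hxy) hc'
    dsimp only
    linarith
  | act _ ih => exact fun x y hxy => max_le_max le_rfl (ih hxy)
  | deepen _ ih => exact ih

/-- Functions computed by monotone ReLU networks are ultramodular: their increments in
nonnegative directions are monotone in the base point. -/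
theorem ReLUplus.ultramodular {n k : ℕ} {F : (Fin n → ℝ) → ℝ} (hF : ReLUplus n k F)
    {x y h : Fin n → ℝ} (hxy : x ≤ y) (hh : 0 ≤ h) :
    F (x + h) - F x ≤ F (y + h) - F y := by
  induction hF with
  | affine a b ha => simp [mul_add, Finset.sum_add_distrib]
  | comb c c' b hc hc' _ _ ihF ihG =>
    have h₁ := mul_le_mul_of_nonneg_left ihF hc
    have h₂ := mul_le_mul_of_nonneg_left ihG hc'
    linarith
  | act hF ih =>
    exact relu_sub_relu_le (hF.monotone (le_add_of_nonneg_right hh)) (hF.monotone hxy)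
      (hF.monotone (add_le_add_left hxy h)) (hF.monotone (le_add_of_nonneg_right hh)) ih
  | deepen _ ih => exact ih

/-- For every `k`, the function `MAX₂(x) = max {x 0, x 1}` is not computable
by any depth-`k` monotone ReLU network. -/
theorem max2_not_in_ReLUplus :
    ∀ k : ℕ, ¬ ReLUplus 2 k (fun x => max (x 0) (x 1)) := by
  intro k hk
  have hxy : (0 : Fin 2 → ℝ) ≤ ![0, 1] := by simp [Pi.le_def, Fin.forall_fin_two]
  have hh : (0 : Fin 2 → ℝ) ≤ ![1, 0] := by simp [Pi.le_def, Fin.forall_fin_two]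
  have := hk.ultramodular hxy hh
  norm_num at this
end
end

section
/- There exists ε > 0 such that for every k and every F ∈ ReLU⁺_{2,k}, there is r > 0 such that the expected value of |F(x) − MAX_2(x)| over x chosen uniformly at random from [0,r]² is greater than ε; that is, (1/r²)·∫_{[0,r]²} |F(x) − max{x_1,x_2}| dx > ε. -/
open MeasureTheory

noncomputable section

theorem continuous_relu : Continuous relu := continuous_const.max continuous_id

theorem monotone_relu : Monotone relu := fun _ _ h => max_le_max le_rfl h

namespace ReLUplus

variable {n k : ℕ} {F : (Fin n → ℝ) → ℝ}

theorem continuous (hF : ReLUplus n k F) : Continuous F := by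
  induction hF with
  | affine a b ha => fun_prop
  | comb c c' b hc hc' hF hG ihF ihG => fun_prop
  | act hF ih => exact continuous_relu.comp ih
  | deepen hF ih => exact ih

theorem monotone_s1 (hF : ReLUplus n k F) : Monotone F := by
  induction hF with
  | affine a b ha =>
    intro x y hxy
    exact add_le_add_left
      (Finset.sum_le_sum fun i _ => mul_le_mul_of_nonneg_left (hxy i) (ha i)) b
  | comb c c' b hc hc' hF hG ihF ihG =>
    intro x y hxy
    have h₁ := mul_le_mul_of_nonneg_left (ihF hxy) hc
    have h₂ := mul_le_mul_of_nonneg_left (ihG hxy) hc'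
    dsimp only
    linarith
  | act hF ih => exact monotone_relu.comp ih
  | deepen hF ih => exact ih

/-- Functions computed by monotone ReLU networks are supermodular. -/
theorem add_le_sup_add_inf (hF : ReLUplus n k F) (x y : Fin n → ℝ) :
    F x + F y ≤ F (x ⊔ y) + F (x ⊓ y) := by
  induction hF with
  | affine a b ha =>
    have h : ∑ i, a i * (x ⊔ y) i + ∑ i, a i * (x ⊓ y) i
        = ∑ i, a i * x i + ∑ i, a i * y i := by
      simp only [← Finset.sum_add_distrib, ← mul_add, Pi.sup_apply, Pi.inf_apply,
        max_add_min]
    linarith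
  | comb c c' b hc hc' hF hG ihF ihG =>
    have h₁ := mul_le_mul_of_nonneg_left ihF hc
    have h₂ := mul_le_mul_of_nonneg_left ihG hc'
    linarith
  | @act k G hG ih =>
    have h₁ := hG.monotone_s1 (inf_le_left : x ⊓ y ≤ x)
    have h₂ := hG.monotone_s1 (inf_le_right : x ⊓ y ≤ y)
    have h₃ := hG.monotone_s1 (le_sup_left : x ≤ x ⊔ y)
    have h₄ := hG.monotone_s1 (le_sup_right : y ≤ x ⊔ y)
    simp only [relu]
    grind
  | deepen hF ih => exact ih

/-- The corners of a square of side `3` whose lower left corner lies in `[0,1]²` witness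
that `max` is far from being supermodular. -/
theorem two_le_sum_abs_sub_max {F : (Fin 2 → ℝ) → ℝ} (hF : ReLUplus 2 k F)
    {x : Fin 2 → ℝ} (hx : x ∈ Set.Icc (0 : Fin 2 → ℝ) 1) :
    2 ≤ ∑ p : Fin 2 × Fin 2, |F (x + ![3 * (p.1 : ℝ), 3 * (p.2 : ℝ)]) -
      max ((x + ![3 * (p.1 : ℝ), 3 * (p.2 : ℝ)]) 0)
        ((x + ![3 * (p.1 : ℝ), 3 * (p.2 : ℝ)]) 1)| := by
  have h := hF.add_le_sup_add_inf (x + ![3, 0]) (x + ![0, 3])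
  have hsup : (x + ![3, 0]) ⊔ (x + ![0, 3]) = x + ![3, 3] := by
    ext i; fin_cases i <;> simp [Matrix.vecHead, Matrix.vecTail]
  have hinf : (x + ![3, 0]) ⊓ (x + ![0, 3]) = x + ![0, 0] := by
    ext i; fin_cases i <;> simp [Matrix.vecHead, Matrix.vecTail]
  rw [hsup, hinf] at h
  have h₀ := hx.1 0
  have h₁ := hx.1 1
  have h₂ := hx.2 0
  have h₃ := hx.2 1
  simp only [Pi.zero_apply, Pi.one_apply] at h₀ h₁ h₂ h₃
  simp only [Fintype.sum_prod_type, Fin.sum_univ_two, Fin.val_zero, Fin.val_one, Nat.cast_zero,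
    Nat.cast_one, mul_zero, mul_one, Pi.add_apply, Matrix.cons_val_zero, Matrix.cons_val_one,
    add_zero]
  rw [max_eq_right (by linarith : x 0 ≤ x 1 + 3), max_eq_left (by linarith : x 1 ≤ x 0 + 3),
    max_add_add_right]
  have hmax : 2 * max (x 0) (x 1) ≤ x 0 + x 1 + 1 := by grind
  have hzero : x + ![0, 0] = x := by
    ext i; fin_cases i <;> simp
  rw [hzero] at h ⊢
  linarith [neg_abs_le (F (x + ![0, 3]) - (x 1 + 3)), le_abs_self (F (x + ![0, 3]) - (x 1 + 3)),
    le_abs_self (F (x + ![3, 0]) - (x 0 + 3)), neg_abs_le (F (x + ![3, 0]) - (x 0 + 3)),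
    le_abs_self (F (x + ![3, 3]) - (max (x 0) (x 1) + 3)), le_abs_self (F x - max (x 0) (x 1))]

end ReLUplus

/-- A translate of the unit cube contained in a box contributes at most the integral over the
box. -/
theorem setIntegral_unit_add_le {n : ℕ} {f : (Fin n → ℝ) → ℝ} (hf : Continuous f)
    (hf₀ : 0 ≤ f) {v b : Fin n → ℝ} (hv : 0 ≤ v) (hb : v + 1 ≤ b) :
    ∫ x in Set.Icc 0 1, f (x + v) ≤ ∫ x in Set.Icc 0 b, f x := by
  have hpre : (fun x => x + v) ⁻¹' Set.Icc v (v + 1) = Set.Icc 0 1 := by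
    simp
  rw [← hpre, (measurePreserving_add_right volume v).setIntegral_preimage_emb
    (MeasurableEquiv.addRight v).measurableEmbedding]
  exact setIntegral_mono_set hf.continuousOn.integrableOn_Icc
    (Filter.Eventually.of_forall hf₀) (Set.Icc_subset_Icc hv hb).eventuallyLE

/-- There is `ε > 0` such that for every `k` and every `F` computable by a
depth-`k` monotone ReLU network, there is `r > 0` such that the average of
`|F x − max {x 0, x 1}|` over `x` uniform in `[0,r]²` exceeds `ε`. -/
theorem monotone_relu_cannot_approx_max2 :
    ∃ ε : ℝ, 0 < ε ∧ ∀ (k : ℕ) (F : (Fin 2 → ℝ) → ℝ), ReLUplus 2 k F →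
      ∃ r : ℝ, 0 < r ∧
        ε < (1 / r ^ 2) *
          ∫ x in Set.Icc (0 : Fin 2 → ℝ) (fun _ => r), |F x - max (x 0) (x 1)| := by
  refine ⟨1 / 64, by norm_num, fun k F hF => ⟨4, by norm_num, ?_⟩⟩
  set f : (Fin 2 → ℝ) → ℝ := fun x => |F x - max (x 0) (x 1)|
  have hf : Continuous f := by
    have := hF.continuous
    fun_prop
  set I := ∫ x in Set.Icc (0 : Fin 2 → ℝ) (fun _ => 4), f x
  let v : Fin 2 × Fin 2 → Fin 2 → ℝ := fun p => ![3 * (p.1 : ℝ), 3 * (p.2 : ℝ)]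
  have hint (p) : IntegrableOn (fun x => f (x + v p)) (Set.Icc 0 1) :=
    (hf.comp (continuous_add_const (v p))).continuousOn.integrableOn_Icc
  have hvol : volume.real (Set.Icc (0 : Fin 2 → ℝ) 1) = 1 := by
    simp [Measure.real, Real.volume_Icc_pi]
  have hlower : 2 ≤ ∫ x in Set.Icc 0 1, ∑ p, f (x + v p) := by
    simpa [hvol] using setIntegral_mono_on (integrableOn_const (C := (2 : ℝ))
        isCompact_Icc.measure_lt_top.ne)
      (integrable_finsetSum _ fun p _ => hint p) measurableSet_Icc
      fun x hx => hF.two_le_sum_abs_sub_max hx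
  rw [integral_finsetSum _ fun p _ => hint p] at hlower
  have hupper (p) : ∫ x in Set.Icc 0 1, f (x + v p) ≤ I := by
    refine setIntegral_unit_add_le hf (fun x => abs_nonneg _) ?_ ?_
    · intro i
      fin_cases i <;> simp [v]
    · obtain ⟨a, b⟩ := p
      intro i
      fin_cases i <;> fin_cases a <;> fin_cases b <;> norm_num [v]
  have h4 : 2 ≤ 4 * I := by
    refine hlower.trans ((Finset.sum_le_sum fun p _ => hupper p).trans_eq ?_)
    simp
  linarith
end
end

section
/- If F ∈ ReLU⁺_{n,k} for some k (i.e., F : ℝⁿ → ℝ is computable by a monotone ReLU network), then F is convex, every subgradient g ∈ ∂F(x) at every point x satisfies g ≥ 0 coordinatewise, and F has isotonic subgradient: ∂F(x) ≤ ∂F(y) whenever x ≤ y coordinatewise. -/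
noncomputable section

/-- The subgradient of `F` at `x`: all `g` with `F y ≥ F x + ⟨g, y − x⟩` for all `y`. -/
def subgrad {n : ℕ} (F : (Fin n → ℝ) → ℝ) (x : Fin n → ℝ) : Set (Fin n → ℝ) :=
  {g | ∀ y : Fin n → ℝ, F x + ∑ i, g i * (y i - x i) ≤ F y}

/-- `A ≤ B` for sets: every `a ∈ A` has `b ∈ B` with `a ≤ b`, and every `b ∈ B`
has `a ∈ A` with `a ≤ b` (coordinatewise order). -/
def SetLE {n : ℕ} (A B : Set (Fin n → ℝ)) : Prop :=
  (∀ a ∈ A, ∃ b ∈ B, a ≤ b) ∧ (∀ b ∈ B, ∃ a ∈ A, a ≤ b)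

/-- `F` has isotonic subgradient: `∂F(x) ≤ ∂F(y)` whenever `x ≤ y`. -/
def IsotonicSubgrad {n : ℕ} (F : (Fin n → ℝ) → ℝ) : Prop :=
  ∀ x y : Fin n → ℝ, x ≤ y → SetLE (subgrad F x) (subgrad F y)

/-- Sandwich form of the Hahn–Banach theorem: an affine minorant of a convex function on a convex
set `C`, exact at a point `y ∈ C`, is dominated on `C` by a global supporting functional at `y`. -/
theorem ConvexOn.exists_mem_subgrad_forall_le {n : ℕ} {F : (Fin n → ℝ) → ℝ}
    (hF : ConvexOn ℝ Set.univ F) {C : Set (Fin n → ℝ)} (hC : Convex ℝ C) {y a : Fin n → ℝ}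
    (hy : y ∈ C) (ha : ∀ z ∈ C, F y + ∑ i, a i * (z i - y i) ≤ F z) :
    ∃ g ∈ subgrad F y, ∀ z ∈ C, ∑ i, a i * (z i - y i) ≤ ∑ i, g i * (z i - y i) := by
  have hcont : Continuous F := hF.locallyLipschitz.continuous
  have hconc : ConcaveOn ℝ C fun z => F y + ∑ i, a i * (z i - y i) := by
    refine ⟨hC, fun u _ v _ s t _ _ hst => le_of_eq ?_⟩
    obtain rfl : s = 1 - t := by linarith
    have : ∑ i, a i * (((1 - t) • u + t • v) i - y i)
        = (1 - t) * ∑ i, a i * (u i - y i) + t * ∑ i, a i * (v i - y i) := by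
      rw [Finset.mul_sum, Finset.mul_sum, ← Finset.sum_add_distrib]
      refine Finset.sum_congr rfl fun i _ => ?_
      simp only [Pi.add_apply, Pi.smul_apply, smul_eq_mul]
      ring
    simp only [smul_eq_mul, this]
    ring
  obtain ⟨f, u, hepi, hhyp⟩ := geometric_hahn_banach_open hF.convex_strict_epigraph
    (by simpa using isOpen_lt (hcont.comp continuous_fst) continuous_snd)
    hconc.convex_hypograph (Set.disjoint_left.2 fun p hp hq =>
      absurd (hp.2.trans_le (hq.2.trans (ha p.1 hq.1))) (lt_irrefl _))
  set c : ℝ := f (0, 1) with hc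
  set φ : (Fin n → ℝ) →ₗ[ℝ] ℝ := (f : (Fin n → ℝ) × ℝ →ₗ[ℝ] ℝ) ∘ₗ LinearMap.inl ℝ _ ℝ with hφ
  have hf (z : Fin n → ℝ) (t : ℝ) : f (z, t) = φ z + t * c := by
    have : (z, t) = (z, (0 : ℝ)) + t • ((0 : Fin n → ℝ), (1 : ℝ)) := by simp
    rw [this, map_add, map_smul]
    simp [hφ, hc]
  have hφ_sub (z : Fin n → ℝ) : φ z - φ y = ∑ i, φ (Pi.single i 1) * (z i - y i) := by
    conv_lhs => rw [← map_sub, pi_eq_sum_univ' (z - y), map_sum]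
    refine Finset.sum_congr rfl fun i _ => ?_
    rw [map_smul, Pi.sub_apply, smul_eq_mul, mul_comm]
  have hu : u ≤ φ y + F y * c := by
    rw [← hf]
    exact hhyp (y, F y) ⟨hy, by simp⟩
  have hcneg : c < 0 := by
    have := hepi (y, F y + 1) ⟨Set.mem_univ _, by simp⟩
    rw [hf] at this
    linarith
  have hsupp (z : Fin n → ℝ) : φ z + F z * c ≤ u := by
    refine le_of_forall_pos_le_add fun ε hε => ?_
    have := hepi (z, F z + ε / -c)
      ⟨Set.mem_univ _, lt_add_of_pos_right _ (div_pos hε (neg_pos.2 hcneg))⟩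
    rw [hf, add_mul, div_neg, neg_mul, div_mul_cancel₀ _ hcneg.ne] at this
    linarith
  have hg (z : Fin n → ℝ) :
      ∑ i, φ (Pi.single i 1) / -c * (z i - y i) = (φ z - φ y) / -c := by
    rw [hφ_sub, Finset.sum_div]
    exact Finset.sum_congr rfl fun i _ => by ring
  refine ⟨fun i => φ (Pi.single i 1) / -c, fun z => ?_, fun z hz => ?_⟩
  · rw [hg, ← le_sub_iff_add_le', div_le_iff₀ (neg_pos.2 hcneg)]
    linarith [hsupp z]
  · have := hhyp (z, F y + ∑ i, a i * (z i - y i)) ⟨hz, le_rfl⟩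
    rw [hf] at this
    rw [hg, le_div_iff₀ (neg_pos.2 hcneg)]
    linarith [hsupp y]

/-- `F` has increasing increments: `F (x + v) - F x` is monotone in `x` for every `v ≥ 0`. -/
def IncreasingIncrements {n : ℕ} (F : (Fin n → ℝ) → ℝ) : Prop :=
  ∀ x y v : Fin n → ℝ, x ≤ y → 0 ≤ v → F (x + v) + F y ≤ F x + F (y + v)

theorem IncreasingIncrements.relu_comp {n : ℕ} {F : (Fin n → ℝ) → ℝ}
    (hF : IncreasingIncrements F) (hmono : Monotone F) :
    IncreasingIncrements fun x => relu (F x) := by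
  intro x y v hxy hv
  have h := hF x y v hxy hv
  have h₁ := hmono hxy
  have h₂ := hmono (le_add_of_nonneg_right hv : x ≤ x + v)
  have h₃ := hmono (add_le_add_left hxy v)
  have h₄ := hmono (le_add_of_nonneg_right hv : y ≤ y + v)
  simp only [relu]
  rcases max_cases 0 (F x) with hx | hx <;> rcases max_cases 0 (F y) with hy | hy <;>
    rcases max_cases 0 (F (x + v)) with hxv | hxv <;>
    rcases max_cases 0 (F (y + v)) with hyv | hyv <;> linarith

theorem ReLUplus.convexOn_monotone_increasingIncrements {n k : ℕ} {F : (Fin n → ℝ) → ℝ}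
    (hF : ReLUplus n k F) :
    ConvexOn ℝ Set.univ F ∧ Monotone F ∧ IncreasingIncrements F := by
  induction hF with
  | affine a b ha =>
    refine ⟨⟨convex_univ, fun u _ v _ s t _ _ hst => le_of_eq ?_⟩, fun x y hxy => ?_,
      fun x y v _ _ => le_of_eq ?_⟩
    · simp only [Pi.add_apply, Pi.smul_apply, smul_eq_mul, mul_add, Finset.sum_add_distrib,
        Finset.mul_sum, mul_left_comm (a _)]
      linear_combination -b * hst
    · exact add_le_add_left (Finset.sum_le_sum fun i _ =>
        mul_le_mul_of_nonneg_left (hxy i) (ha i)) b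
    · simp only [Pi.add_apply, mul_add, Finset.sum_add_distrib]
      ring
  | comb c c' b hc hc' _ _ ihF ihG =>
    obtain ⟨hF₁, hF₂, hF₃⟩ := ihF
    obtain ⟨hG₁, hG₂, hG₃⟩ := ihG
    refine ⟨((hF₁.smul hc).add (hG₁.smul hc')).add_const b, fun x y hxy => ?_,
      fun x y v hxy hv => ?_⟩
    · have h₁ := mul_le_mul_of_nonneg_left (hF₂ hxy) hc
      have h₂ := mul_le_mul_of_nonneg_left (hG₂ hxy) hc'
      dsimp only
      linarith
    · have h₁ := mul_le_mul_of_nonneg_left (hF₃ x y v hxy hv) hc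
      have h₂ := mul_le_mul_of_nonneg_left (hG₃ x y v hxy hv) hc'
      dsimp only
      linarith
  | act _ ih =>
    obtain ⟨h₁, h₂, h₃⟩ := ih
    exact ⟨(convexOn_const 0 convex_univ).sup h₁, monotone_const.sup h₂, h₃.relu_comp h₂⟩
  | deepen _ ih => exact ih

theorem Monotone.nonneg_of_mem_subgrad {n : ℕ} {F : (Fin n → ℝ) → ℝ} (hF : Monotone F)
    {x g : Fin n → ℝ} (hg : g ∈ subgrad F x) : 0 ≤ g := by
  intro i
  have h := hg (x - Pi.single i 1)
  have hle : F (x - Pi.single i 1) ≤ F x := hF (sub_le_self _ <| Pi.single_nonneg.2 zero_le_one)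
  simp only [Pi.sub_apply, sub_sub_cancel_left, mul_neg, Finset.sum_neg_distrib,
    Pi.single_apply, mul_ite, mul_one, mul_zero, Finset.sum_ite_eq', Finset.mem_univ,
    if_true] at h
  simp only [Pi.zero_apply]
  linarith

theorem IncreasingIncrements.isotonicSubgrad {n : ℕ} {F : (Fin n → ℝ) → ℝ}
    (hF : IncreasingIncrements F) (hconv : ConvexOn ℝ Set.univ F) : IsotonicSubgrad F := by
  intro x y hxy
  constructor
  · intro a ha
    obtain ⟨g, hg, hag⟩ := hconv.exists_mem_subgrad_forall_le (convex_Ici y)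
      (a := a) Set.self_mem_Ici fun z hz => by
        have h₁ := hF x y (z - y) hxy (sub_nonneg.2 hz)
        have h₂ := ha (x + (z - y))
        simp only [Pi.add_apply, Pi.sub_apply, add_sub_cancel_left, add_sub_cancel] at h₁ h₂
        linarith
    refine ⟨g, hg, fun i => ?_⟩
    simpa [Pi.single_apply] using hag (y + Pi.single i 1)
      (Set.mem_Ici.2 <| le_add_of_nonneg_right <| Pi.single_nonneg.2 zero_le_one)
  · intro b hb
    obtain ⟨g, hg, hbg⟩ := hconv.exists_mem_subgrad_forall_le (convex_Iic x)
      (a := b) Set.self_mem_Iic fun z hz => by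
        have h₁ := hF z (z + (y - x)) (x - z) (le_add_of_nonneg_right (sub_nonneg.2 hxy))
          (sub_nonneg.2 hz)
        have h₂ := hb (z + (y - x))
        have h₃ : z + (y - x) + (x - z) = y := by abel
        have h₄ (i : Fin n) : (z + (y - x)) i - y i = z i - x i := by
          simp only [Pi.add_apply, Pi.sub_apply]
          ring
        simp only [h₃, h₄, add_sub_cancel] at h₁ h₂
        linarith
    refine ⟨g, hg, fun i => ?_⟩
    simpa [Pi.single_apply] using hbg (x - Pi.single i 1)
      (Set.mem_Iic.2 <| sub_le_self _ <| Pi.single_nonneg.2 zero_le_one)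

/-- Any function computable by a monotone ReLU network is convex, has
coordinatewise nonnegative subgradients everywhere, and has isotonic subgradient. -/
theorem ReLUplus_convex_nonneg_isotonic {n k : ℕ} {F : (Fin n → ℝ) → ℝ}
    (hF : ReLUplus n k F) :
    ConvexOn ℝ Set.univ F ∧
    (∀ x : Fin n → ℝ, ∀ g ∈ subgrad F x, (0 : Fin n → ℝ) ≤ g) ∧
    IsotonicSubgrad F := by
  obtain ⟨hconv, hmono, hincr⟩ := hF.convexOn_monotone_increasingIncrements
  exact ⟨hconv, fun _ _ hg => hmono.nonneg_of_mem_subgrad hg, hincr.isotonicSubgrad hconv⟩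
end
end

section
/- There exists a constant ε > 0 such that for every convex CPWL function F : ℝ² → ℝ with isotonic subgradient, the expected value of |F(x) − MAX_2(x)| over x uniformly distributed in [0,1]² is greater than ε; that is, ∫_{[0,1]²} |F(x) − max{x_1,x_2}| dx > ε. -/
open MeasureTheory

noncomputable section

/-- `F : ℝⁿ → ℝ` is continuous piecewise affine with finitely many pieces. -/
def IsCPWL {n : ℕ} (F : (Fin n → ℝ) → ℝ) : Prop :=
  Continuous F ∧ ∃ s : Finset ((Fin n → ℝ) × ℝ),
    ∀ x : Fin n → ℝ, ∃ p ∈ s, F x = (∑ i, p.1 i * x i) + p.2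

/-- A continuous convex function on `ℝⁿ` has a subgradient at every point. -/
theorem subgrad_nonempty {n : ℕ} {F : (Fin n → ℝ) → ℝ} (hc : Continuous F)
    (hF : ConvexOn ℝ Set.univ F) (x : Fin n → ℝ) : (subgrad F x).Nonempty := by
  have hopen : IsOpen {p : (Fin n → ℝ) × ℝ | p.1 ∈ Set.univ ∧ F p.1 < p.2} := by
    simpa using isOpen_lt (hc.comp continuous_fst) continuous_snd
  obtain ⟨f, hf⟩ := geometric_hahn_banach_open_point hF.convex_strict_epigraph hopen
    (x := (x, F x)) (by simp)
  have hsplit : ∀ y t, f (y, t) = f (y, 0) + t * f (0, 1) := by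
    intro y t
    have h : ((y, t) : (Fin n → ℝ) × ℝ) = (y, 0) + t • (0, 1) := by simp
    rw [h, map_add, map_smul, smul_eq_mul]
  have hneg : f (0, 1) < 0 := by
    have h := hf (x, F x + 1) (by simp)
    rw [hsplit x (F x + 1), hsplit x (F x)] at h
    linarith
  have hbelow : ∀ y, f (y, F y) ≤ f (x, F x) := by
    intro y
    refine le_of_forall_pos_le_add fun δ hδ => ?_
    have h := hf (y, F y + δ / (-f (0, 1)))
      ⟨trivial, lt_add_of_pos_right _ (div_pos hδ (neg_pos.2 hneg))⟩
    rw [hsplit y (F y + _)] at h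
    have h' : δ / (-f (0, 1)) * f (0, 1) = -δ := by
      rw [div_neg, neg_mul, div_mul_cancel₀ _ hneg.ne]
    rw [hsplit y (F y)]
    nlinarith
  refine ⟨fun i => f (Pi.single i 1, 0) / (-f (0, 1)), fun y => ?_⟩
  have hlin : ∑ i, f (Pi.single i 1, 0) / (-f (0, 1)) * (y i - x i)
      = (f (y, 0) - f (x, 0)) / (-f (0, 1)) := by
    have h : f (y, 0) - f (x, 0) = ∑ i, (y i - x i) * f (Pi.single i 1, 0) := by
      rw [← map_sub, Prod.mk_sub_mk, sub_zero]
      have h := LinearMap.pi_apply_eq_sum_univ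
        (f.toLinearMap ∘ₗ LinearMap.inl ℝ (Fin n → ℝ) ℝ) (y - x)
      have hsingle : ∀ i : Fin n, (fun j => if i = j then (1 : ℝ) else 0) = Pi.single i 1 :=
        fun i => by ext j; simp [Pi.single_apply, eq_comm]
      simpa [hsingle] using h
    rw [h, Finset.sum_div]
    exact Finset.sum_congr rfl fun i _ => by ring
  have h := hbelow y
  rw [hsplit y (F y), hsplit x (F x)] at h
  rw [hlin, ← le_sub_iff_add_le', div_le_iff₀ (neg_pos.2 hneg)]
  linarith

/-- A continuous convex function with isotonic subgradient has increasing differences: its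
increment along a nonnegative direction is monotone in the base point. -/
theorem IsotonicSubgrad.add_sub_le_add_sub {n : ℕ} {F : (Fin n → ℝ) → ℝ} (hc : Continuous F)
    (hF : ConvexOn ℝ Set.univ F) (hiso : IsotonicSubgrad F) {x y d : Fin n → ℝ}
    (hxy : x ≤ y) (hd : 0 ≤ d) : F (x + d) - F x ≤ F (y + d) - F y := by
  have step : ∀ {u v e : Fin n → ℝ}, u ≤ v → 0 ≤ e → F u - F (u - e) ≤ F (v + e) - F v := by
    intro u v e huv he
    obtain ⟨G, hG⟩ := subgrad_nonempty hc hF v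
    obtain ⟨g, hg, hgG⟩ := (hiso u v huv).2 G hG
    have h₁ := hG (v + e)
    have h₂ := hg (u - e)
    have h₃ : ∑ i, g i * e i ≤ ∑ i, G i * e i :=
      Finset.sum_le_sum fun i _ => mul_le_mul_of_nonneg_right (hgG i) (he i)
    simp only [Pi.add_apply, Pi.sub_apply, add_sub_cancel_left, sub_sub_cancel_left, mul_neg,
      Finset.sum_neg_distrib] at h₁ h₂
    linarith
  have key : ∀ N : ℕ, F (x + d - (1 / ((N : ℝ) + 1)) • d) - F (x - (1 / ((N : ℝ) + 1)) • d)
      ≤ F (y + d) - F y := by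
    intro N
    set r : ℝ := 1 / ((N : ℝ) + 1) with hr
    have hr0 : 0 ≤ r := by positivity
    have hNr : (((N + 1 : ℕ) : ℝ)) * r = 1 := by
      rw [hr]; push_cast; field_simp
    have hsum := Finset.sum_le_sum fun (j : ℕ) (_ : j ∈ Finset.range (N + 1)) =>
      step (add_le_add_left hxy (((j : ℝ) * r) • d)) (smul_nonneg hr0 hd)
    have hx := Finset.sum_range_sub (fun j : ℕ => F (x + ((j : ℝ) * r) • d - r • d)) (N + 1)
    have hy := Finset.sum_range_sub (fun j : ℕ => F (y + ((j : ℝ) * r) • d)) (N + 1)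
    simp only [hNr, one_smul, Nat.cast_zero, zero_mul, zero_smul, add_zero] at hx hy
    rw [← hx, ← hy]
    have hstep : ∀ (z : Fin n → ℝ) (j : ℕ),
        z + (((j + 1 : ℕ) : ℝ) * r) • d = z + ((j : ℝ) * r) • d + r • d := by
      intro z j
      push_cast
      module
    simpa only [hstep, add_sub_cancel_right] using hsum
  have hlim : Filter.Tendsto (fun N : ℕ => 1 / ((N : ℝ) + 1)) Filter.atTop (nhds 0) :=
    tendsto_one_div_add_atTop_nhds_zero_nat
  have hcont : Continuous fun r : ℝ => F (x + d - r • d) - F (x - r • d) := by fun_prop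
  have h := (hcont.tendsto 0).comp hlim
  simp only [zero_smul, sub_zero] at h
  exact le_of_tendsto' h key

/-- The integral over a translated box is at most the integral over a box containing it, for a
nonnegative continuous function. -/
theorem setIntegral_Icc_comp_add_le {n : ℕ} {f : (Fin n → ℝ) → ℝ} (hc : Continuous f)
    (hf : ∀ x, 0 ≤ f x) {a b p q v : Fin n → ℝ} (hp : p ≤ a + v) (hq : b + v ≤ q) :
    ∫ x in Set.Icc a b, f (x + v) ≤ ∫ x in Set.Icc p q, f x := by
  have h := (measurePreserving_add_right volume v).setIntegral_preimage_emb
    (measurableEmbedding_addRight v) f (Set.Icc (a + v) (b + v))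
  rw [Set.preimage_add_const_Icc, add_sub_cancel_right, add_sub_cancel_right] at h
  rw [h]
  exact setIntegral_mono_set (hc.continuousOn.integrableOn_compact isCompact_Icc)
    (Filter.Eventually.of_forall hf) (Set.Icc_subset_Icc hp hq).eventuallyLE

/-- There is `ε > 0` such that every convex CPWL `F : ℝ² → ℝ` with isotonic
subgradient satisfies `∫_{[0,1]²} |F x − max {x 0, x 1}| dx > ε`. -/
theorem isotonic_cannot_approx_max2 :
    ∃ ε : ℝ, 0 < ε ∧ ∀ F : (Fin 2 → ℝ) → ℝ,
      IsCPWL F → ConvexOn ℝ Set.univ F → IsotonicSubgrad F →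
      ε < ∫ x in Set.Icc (0 : Fin 2 → ℝ) (1 : Fin 2 → ℝ), |F x - max (x 0) (x 1)| := by
  refine ⟨1 / 512, by norm_num, fun F hcpwl hF hiso => ?_⟩
  have hc : Continuous F := hcpwl.1
  set f : (Fin 2 → ℝ) → ℝ := fun x => |F x - max (x 0) (x 1)| with hfdef
  have hfc : Continuous f := by fun_prop
  have hf0 : ∀ x, 0 ≤ f x := fun x => abs_nonneg _
  set b : Fin 2 → ℝ := fun _ => 1 / 4 with hb
  have htrans : ∀ s t : ℝ, 0 ≤ s → s ≤ 1 / 2 → 0 ≤ t → t ≤ 1 / 2 →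
      ∫ x in Set.Icc 0 b, f (x + ![s, t]) ≤ ∫ x in Set.Icc 0 1, f x := by
    intro s t hs hs' ht ht'
    refine setIntegral_Icc_comp_add_le hfc hf0 ?_ ?_ <;> intro i <;> fin_cases i <;>
      simp [hb] <;> linarith
  have hint : ∀ v, IntegrableOn (fun x => f (x + v)) (Set.Icc 0 b) := fun v =>
    (Continuous.continuousOn (by fun_prop)).integrableOn_compact isCompact_Icc
  have hpt : ∀ x ∈ Set.Icc 0 b, (1 / 4 : ℝ) ≤
      f (x + ![0, 0]) + f (x + ![1 / 2, 0]) + (f (x + ![0, 1 / 2]) + f (x + ![1 / 2, 1 / 2])) := by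
    intro x hx
    have h0 := hx.1 0
    have h1 := hx.1 1
    have h0' := hx.2 0
    have h1' := hx.2 1
    simp only [hb, Pi.zero_apply] at h0 h1 h0' h1'
    have hsup := IsotonicSubgrad.add_sub_le_add_sub hc hF hiso (x := x + ![0, 0])
      (y := x + ![1 / 2, 0]) (d := ![0, 1 / 2])
      (by intro i; fin_cases i <;> simp) (by intro i; fin_cases i <;> simp)
    rw [add_assoc, add_assoc] at hsup
    simp only [Matrix.cons_add_cons, Matrix.empty_add_empty, zero_add, add_zero] at hsup
    have m1 := max_eq_left (show x 1 + 0 ≤ x 0 + 1 / 2 by linarith)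
    have m2 := max_eq_right (show x 0 + 0 ≤ x 1 + 1 / 2 by linarith)
    have m3 := max_add_add_right (x 0) (x 1) (1 / 2)
    have m4 := max_add_add_right (x 0) (x 1) 0
    have m5 : 2 * max (x 0) (x 1) ≤ x 0 + x 1 + 1 / 4 := by
      rcases max_cases (x 0) (x 1) with ⟨h, _⟩ | ⟨h, _⟩ <;> rw [h] <;> linarith
    simp only [hfdef, Pi.add_apply, Matrix.cons_val_zero, Matrix.cons_val_one]
    rw [m1, m2, m3, m4]
    have a1 := le_abs_self (F (x + ![0, 0]) - (max (x 0) (x 1) + 0))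
    have a2 := neg_abs_le (F (x + ![1 / 2, 0]) - (x 0 + 1 / 2))
    have a3 := neg_abs_le (F (x + ![0, 1 / 2]) - (x 1 + 1 / 2))
    have a4 := le_abs_self (F (x + ![1 / 2, 1 / 2]) - (max (x 0) (x 1) + 1 / 2))
    linarith
  have hmono := setIntegral_mono_on (integrableOn_const (μ := volume) isCompact_Icc.measure_ne_top)
    (((hint ![0, 0]).add (hint ![1 / 2, 0])).add ((hint ![0, 1 / 2]).add (hint ![1 / 2, 1 / 2])))
    measurableSet_Icc hpt
  rw [integral_add' ((hint _).add (hint _)) ((hint _).add (hint _)),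
    integral_add' (hint _) (hint _), integral_add' (hint _) (hint _), setIntegral_const,
    Measure.real, Real.volume_Icc_pi_toReal (by intro i; simp [hb])] at hmono
  simp only [hb, Fin.prod_univ_two, Pi.zero_apply, smul_eq_mul] at hmono
  have t1 := htrans 0 0 (by norm_num) (by norm_num) (by norm_num) (by norm_num)
  have t2 := htrans (1 / 2) 0 (by norm_num) (by norm_num) (by norm_num) (by norm_num)
  have t3 := htrans 0 (1 / 2) (by norm_num) (by norm_num) (by norm_num) (by norm_num)
  have t4 := htrans (1 / 2) (1 / 2) (by norm_num) (by norm_num) (by norm_num) (by norm_num)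
  linarith
end
end

section
/- If F : ℝ² → ℝ is CPWL, homogeneous, monotone, convex and has isotonic subgradient, then F ∈ ReLU⁺_{2,2}; that is, F is computable by a depth-2 monotone ReLU network. -/
noncomputable section

/-- The standard bilinear form on the plane. -/
def planeDot (w z : ℝ × ℝ) : ℝ := w.1 * z.1 + w.2 * z.2

/-- The sum of the ridge functions `relu ⟨e, ·⟩` over `e ∈ E`. -/
def ridgeSum (E : Multiset (ℝ × ℝ)) (z : ℝ × ℝ) : ℝ :=
  (E.map fun e => relu (planeDot e z)).sum

/-- A quantity increasing with the slope of a nonzero vector of the nonnegative quadrant. -/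
def steepness (e : ℝ × ℝ) : ℝ := e.2 / (e.1 + e.2)

theorem relu_of_nonneg {t : ℝ} (h : 0 ≤ t) : relu t = t := max_eq_right h

theorem relu_of_nonpos {t : ℝ} (h : t ≤ 0) : relu t = 0 := max_eq_left h

theorem relu_nonneg (t : ℝ) : 0 ≤ relu t := le_max_left _ _

theorem relu_mul {c : ℝ} (hc : 0 ≤ c) (t : ℝ) : relu (c * t) = c * relu t := by
  rcases le_total 0 t with h | h
  · rw [relu_of_nonneg h, relu_of_nonneg (mul_nonneg hc h)]
  · rw [relu_of_nonpos h, relu_of_nonpos (mul_nonpos_of_nonneg_of_nonpos hc h), mul_zero]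

theorem planeDot_add (v w z : ℝ × ℝ) : planeDot (v + w) z = planeDot v z + planeDot w z := by
  simp only [planeDot, Prod.fst_add, Prod.snd_add]; ring

theorem planeDot_sub (v w z : ℝ × ℝ) : planeDot (v - w) z = planeDot v z - planeDot w z := by
  simp only [planeDot, Prod.fst_sub, Prod.snd_sub]; ring

theorem planeDot_smul (c : ℝ) (w z : ℝ × ℝ) : planeDot (c • w) z = c * planeDot w z := by
  simp only [planeDot, Prod.smul_fst, Prod.smul_snd, smul_eq_mul]; ring

theorem planeDot_nonneg {w z : ℝ × ℝ} (hw : 0 ≤ w) (hz : 0 ≤ z) : 0 ≤ planeDot w z :=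
  add_nonneg (mul_nonneg hw.1 hz.1) (mul_nonneg hw.2 hz.2)

theorem planeDot_nonpos {w z : ℝ × ℝ} (hw : 0 ≤ w) (hz : z ≤ 0) : planeDot w z ≤ 0 :=
  add_nonpos (mul_nonpos_of_nonneg_of_nonpos hw.1 hz.1)
    (mul_nonpos_of_nonneg_of_nonpos hw.2 hz.2)

@[simp] theorem ridgeSum_zero (z : ℝ × ℝ) : ridgeSum 0 z = 0 := by simp [ridgeSum]

@[simp] theorem ridgeSum_cons (e : ℝ × ℝ) (E : Multiset (ℝ × ℝ)) (z : ℝ × ℝ) :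
    ridgeSum (e ::ₘ E) z = relu (planeDot e z) + ridgeSum E z := by simp [ridgeSum]

@[simp] theorem ridgeSum_add (E E' : Multiset (ℝ × ℝ)) (z : ℝ × ℝ) :
    ridgeSum (E + E') z = ridgeSum E z + ridgeSum E' z := by simp [ridgeSum]

theorem ridgeSum_nonneg (E : Multiset (ℝ × ℝ)) (z : ℝ × ℝ) : 0 ≤ ridgeSum E z :=
  Multiset.sum_nonneg fun t ht => by
    obtain ⟨e, -, rfl⟩ := Multiset.mem_map.1 ht
    exact relu_nonneg _

theorem ridgeSum_eq_zero {E : Multiset (ℝ × ℝ)} {z : ℝ × ℝ}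
    (h : ∀ e ∈ E, planeDot e z ≤ 0) : ridgeSum E z = 0 := by
  induction E using Multiset.induction_on with
  | empty => simp
  | cons e E ih =>
    rw [ridgeSum_cons, relu_of_nonpos (h e (Multiset.mem_cons_self e E)),
      ih fun e' he' => h e' (Multiset.mem_cons_of_mem he'), add_zero]

theorem ridgeSum_eq_planeDot_sum {E : Multiset (ℝ × ℝ)} {z : ℝ × ℝ}
    (h : ∀ e ∈ E, 0 ≤ planeDot e z) : ridgeSum E z = planeDot E.sum z := by
  induction E using Multiset.induction_on with
  | empty => simp [planeDot]
  | cons e E ih =>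
    rw [ridgeSum_cons, relu_of_nonneg (h e (Multiset.mem_cons_self e E)), Multiset.sum_cons,
      planeDot_add, ih fun e' he' => h e' (Multiset.mem_cons_of_mem he')]

theorem cross_le_of_steepness_le {e e' : ℝ × ℝ} (he : 0 ≤ e) (he' : 0 ≤ e')
    (h : steepness e ≤ steepness e') : e.2 * e'.1 ≤ e.1 * e'.2 := by
  obtain ⟨h1, h2⟩ := he
  obtain ⟨h3, h4⟩ := he'
  simp only [Prod.fst_zero, Prod.snd_zero] at h1 h2 h3 h4
  rcases (add_nonneg h1 h2).eq_or_lt with h0 | h0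
  · have h5 : e.1 = 0 := by linarith
    have h6 : e.2 = 0 := by linarith
    simp [h5, h6]
  rcases (add_nonneg h3 h4).eq_or_lt with h0' | h0'
  · have h5 : e'.1 = 0 := by linarith
    have h6 : e'.2 = 0 := by linarith
    simp [h5, h6]
  rw [steepness, steepness, div_le_div_iff₀ h0 h0'] at h
  linarith

theorem planeDot_nonpos_of_steeper {e e' z : ℝ × ℝ} (he : 0 ≤ e) (he' : 0 ≤ e')
    (h : e'.2 * e.1 ≤ e'.1 * e.2) (h1 : z.1 ≤ 0) (hz : planeDot e z < 0) :
    planeDot e' z ≤ 0 := by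
  obtain ⟨ha, hb⟩ := he
  obtain ⟨hc, hd⟩ := he'
  simp only [Prod.fst_zero, Prod.snd_zero, planeDot] at *
  rcases hb.eq_or_lt with h0 | h0
  · have hpos : 0 < e.1 := by
      rcases ha.eq_or_lt with h3 | h3
      · rw [← h3, ← h0] at hz; simp at hz
      · exact h3
    have : e'.2 = 0 := by
      rw [← h0, mul_zero] at h
      nlinarith
    rw [this]
    nlinarith
  · by_contra! hcon
    nlinarith [mul_pos h0 hcon, mul_nonneg hd (neg_nonneg.2 hz.le),
      mul_nonneg (sub_nonneg.2 h) (neg_nonneg.2 h1)]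

/-- On the second quadrant, a rectified sum of ridge functions is a sum of ridge functions. -/
theorem exists_ridgeSum_eq_relu_add (E : Multiset (ℝ × ℝ)) (hE : ∀ e ∈ E, 0 ≤ e)
    (a : ℝ × ℝ) (ha : 0 ≤ a) :
    ∃ E' : Multiset (ℝ × ℝ), (∀ e ∈ E', 0 ≤ e) ∧ E'.sum = a + E.sum ∧
      ∀ z : ℝ × ℝ, z.1 ≤ 0 →
        relu (planeDot a z + ridgeSum E z) = ridgeSum E' z := by
  induction E using Multiset.strongInductionOn generalizing a with
  | ih E ih =>
    by_cases hst : ∀ e ∈ E, e.2 * a.1 ≤ e.1 * a.2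
    · refine ⟨a ::ₘ E, ?_, by simp, fun z h1 => ?_⟩
      · simpa using ⟨ha, fun x y h => hE (x, y) h⟩
      · rcases lt_or_ge (planeDot a z) 0 with h | h
        · have h0 : ridgeSum E z = 0 := ridgeSum_eq_zero fun e he =>
            planeDot_nonpos_of_steeper ha (hE e he) (hst e he) h1 h
          simp [h0]
        · rw [ridgeSum_cons, relu_of_nonneg h,
            relu_of_nonneg (add_nonneg h (ridgeSum_nonneg E z))]
    · push Not at hst
      obtain ⟨e₀, he₀, hlt⟩ := hst
      obtain ⟨e, he, hmax⟩ := E.toFinset.exists_max_image steepness ⟨e₀, by simpa using he₀⟩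
      simp only [Multiset.mem_toFinset] at he hmax
      obtain ⟨E₁, rfl⟩ := Multiset.exists_cons_of_mem he
      have hcr : ∀ e' ∈ e ::ₘ E₁, e'.2 * e.1 ≤ e'.1 * e.2 := fun e' he' =>
        cross_le_of_steepness_le (hE e' he') (hE e he) (hmax e' he')
      have hae : a.2 * e.1 ≤ a.1 * e.2 := by
        refine cross_le_of_steepness_le ha (hE e he) (le_trans ?_ (hmax e₀ he₀))
        by_contra! hcon
        exact absurd (cross_le_of_steepness_le (hE e₀ he₀) ha hcon.le) (not_le.2 hlt)
      obtain ⟨E', h1, h2, h3⟩ := ih E₁ (Multiset.lt_cons_self E₁ e)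
        (fun e' he' => hE e' (Multiset.mem_cons_of_mem he')) (a + e) (add_nonneg ha (hE e he))
      refine ⟨E', h1, by rw [h2, Multiset.sum_cons, add_assoc], fun z hz1 => ?_⟩
      rw [← h3 z hz1, ridgeSum_cons, planeDot_add]
      rcases lt_or_ge (planeDot e z) 0 with h | h
      · have h0 : ridgeSum E₁ z = 0 := ridgeSum_eq_zero fun e' he' =>
          planeDot_nonpos_of_steeper (hE e he) (hE e' (Multiset.mem_cons_of_mem he'))
            (hcr e' (Multiset.mem_cons_of_mem he')) hz1 h
        have h4 := planeDot_nonpos_of_steeper (hE e he) ha hae hz1 h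
        rw [h0, relu_of_nonpos h.le, relu_of_nonpos (by linarith), relu_of_nonpos (by linarith)]
      · rw [relu_of_nonneg h, add_assoc]

/-- On the second quadrant, a support function of a finite set is a sum of ridge functions,
up to a linear function. -/
theorem exists_isGreatest_ridgeSum (V : Finset (ℝ × ℝ)) (hV : V.Nonempty) :
    ∃ w ∈ V, ∃ E : Multiset (ℝ × ℝ), (∀ e ∈ E, 0 ≤ e) ∧ w + E.sum ∈ V ∧
      ∀ z : ℝ × ℝ, z.1 ≤ 0 → 0 ≤ z.2 →
        IsGreatest ((fun p => planeDot p z) '' (V : Set (ℝ × ℝ)))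
          (planeDot w z + ridgeSum E z) := by
  induction V using Finset.induction_on_max_value (fun p : ℝ × ℝ => -p.2) with
  | empty => simp at hV
  | insert a V haV hmin ih =>
    rcases V.eq_empty_or_nonempty with rfl | hne
    · exact ⟨a, by simp, 0, by simp, by simp, fun z _ _ => by simp⟩
    obtain ⟨w, hw, E, hE, hs, hg⟩ := ih hne
    have h2 : a.2 ≤ w.2 := by simpa using hmin w hw
    rcases le_or_gt a.1 w.1 with h1 | h1
    · obtain ⟨E', hE', hs', hr⟩ := exists_ridgeSum_eq_relu_add E hE (w - a)
        (sub_nonneg.2 ⟨h1, h2⟩)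
      refine ⟨a, by simp, E', hE', ?_, fun z hz1 hz2 => ?_⟩
      · rw [hs', ← add_assoc, add_sub_cancel]
        exact Finset.mem_insert_of_mem hs
      · have := (hg z hz1 hz2).insert (planeDot a z)
        rw [Finset.coe_insert, Set.image_insert_eq]
        have key : max (planeDot a z) (planeDot w z + ridgeSum E z) =
            planeDot a z + ridgeSum E' z := by
          rw [← hr z hz1, relu, planeDot_sub, ← max_add_add_left]
          congr 1 <;> ring
        exact key ▸ this
    · refine ⟨w, Finset.mem_insert_of_mem hw, E, hE, Finset.mem_insert_of_mem hs,
        fun z hz1 hz2 => ?_⟩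
      have := (hg z hz1 hz2).insert (planeDot a z)
      rw [Finset.coe_insert, Set.image_insert_eq]
      rwa [max_eq_right] at this
      have h3 := ridgeSum_nonneg E z
      simp only [planeDot]
      nlinarith [mul_nonneg (sub_nonneg.2 h1.le) (neg_nonneg.2 hz1),
        mul_nonneg (sub_nonneg.2 h2) hz2]

theorem planeDot_nonneg_of_steeper {e e' z : ℝ × ℝ} (he : 0 ≤ e) (he' : 0 ≤ e')
    (h : e'.2 * e.1 ≤ e'.1 * e.2) (h1 : 0 ≤ z.1) (hz : 0 < planeDot e z) :
    0 ≤ planeDot e' z := by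
  have := planeDot_nonpos_of_steeper (z := -z) he he' h (by simpa using h1)
    (by simp only [planeDot, Prod.fst_neg, Prod.snd_neg] at hz ⊢; linarith)
  simp only [planeDot, Prod.fst_neg, Prod.snd_neg] at this ⊢
  linarith

theorem relu_add_relu_of_steeper {e e' : ℝ × ℝ} (he : 0 ≤ e) (he' : 0 ≤ e')
    (h : e'.2 * e.1 ≤ e'.1 * e.2) (z : ℝ × ℝ) :
    relu (planeDot e z + relu (planeDot e' z)) =
      if z.1 ≤ 0 then relu (planeDot e z) + relu (planeDot e' z)
      else relu (planeDot (e + e') z) := by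
  rw [planeDot_add]
  split_ifs with hz
  · rcases lt_or_ge (planeDot e z) 0 with h0 | h0
    · have := planeDot_nonpos_of_steeper he he' h hz h0
      rw [relu_of_nonpos this, add_zero, add_zero]
    · rw [relu_of_nonneg h0, relu_of_nonneg (add_nonneg h0 (relu_nonneg _))]
  · rcases lt_or_ge (planeDot e' z) 0 with h0 | h0
    · have : planeDot e z ≤ 0 := by
        by_contra! hc
        exact absurd (planeDot_nonneg_of_steeper he he' h (not_le.1 hz).le hc) (not_le.2 h0)
      rw [relu_of_nonpos h0.le, relu_of_nonpos (by linarith), relu_of_nonpos (by linarith)]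
    · rw [relu_of_nonneg h0]

theorem relu_add_relu_of_shallower {e e' : ℝ × ℝ} (he : 0 ≤ e) (he' : 0 ≤ e')
    (h : e'.2 * e.1 ≤ e'.1 * e.2) (z : ℝ × ℝ) :
    relu (planeDot e' z + relu (planeDot e z)) =
      if z.1 ≤ 0 then relu (planeDot (e + e') z)
      else relu (planeDot e z) + relu (planeDot e' z) := by
  rw [planeDot_add]
  split_ifs with hz
  · rcases lt_or_ge (planeDot e z) 0 with h0 | h0
    · have := planeDot_nonpos_of_steeper he he' h hz h0
      rw [relu_of_nonpos h0.le, relu_of_nonpos (by linarith), relu_of_nonpos (by linarith)]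
    · rw [relu_of_nonneg h0, add_comm]
  · rcases lt_or_ge (planeDot e' z) 0 with h0 | h0
    · have : planeDot e z ≤ 0 := by
        by_contra! hc
        exact absurd (planeDot_nonneg_of_steeper he he' h (not_le.1 hz).le hc) (not_le.2 h0)
      rw [relu_of_nonpos this, add_zero, zero_add]
    · rw [relu_of_nonneg h0, relu_of_nonneg (add_nonneg h0 (relu_nonneg _)), add_comm]

theorem ReLUplus.add {n k : ℕ} {F G : (Fin n → ℝ) → ℝ} (hF : ReLUplus n k F)
    (hG : ReLUplus n k G) : ReLUplus n k (fun x => F x + G x) := by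
  simpa using ReLUplus.comb 1 1 0 zero_le_one zero_le_one hF hG

theorem ReLUplus.planeDot {e : ℝ × ℝ} (he : 0 ≤ e) :
    ReLUplus 2 0 (fun x => _root_.planeDot e (x 0, x 1)) := by
  have := ReLUplus.affine (n := 2) ![e.1, e.2] 0 (by
    intro i; fin_cases i
    · exact he.1
    · exact he.2)
  simpa [Fin.sum_univ_two, _root_.planeDot] using this

theorem ReLUplus.relu_planeDot_add_relu {e e' : ℝ × ℝ} (he : 0 ≤ e) (he' : 0 ≤ e') :
    ReLUplus 2 2 (fun x =>
      relu (_root_.planeDot e (x 0, x 1) + relu (_root_.planeDot e' (x 0, x 1)))) :=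
  ((ReLUplus.planeDot he).deepen.add (ReLUplus.planeDot he').act).act

open Classical in
/-- The function equal to `ridgeSum E` where `q` holds and to `ridgeSum F` elsewhere is computable
by a depth-2 monotone network. -/
def SpliceComputable (q : ℝ × ℝ → Prop) (E F : Multiset (ℝ × ℝ)) : Prop :=
  ReLUplus 2 2 (fun x =>
    if q (x 0, x 1) then ridgeSum E (x 0, x 1) else ridgeSum F (x 0, x 1))

namespace SpliceComputable

variable {q : ℝ × ℝ → Prop} {E E' F F' : Multiset (ℝ × ℝ)}

theorem symm (h : SpliceComputable q E F) : SpliceComputable (fun z => ¬ q z) F E := by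
  unfold SpliceComputable at *
  convert h using 2 with x
  by_cases hx : q (x 0, x 1) <;> simp [hx]

theorem of_not (h : SpliceComputable (fun z => ¬ q z) F E) : SpliceComputable q E F := by
  simpa using h.symm

theorem add (h : SpliceComputable q E F) (h' : SpliceComputable q E' F') :
    SpliceComputable q (E + E') (F + F') := by
  unfold SpliceComputable at *
  convert ReLUplus.add h h' using 2 with x
  by_cases hx : q (x 0, x 1) <;> simp [hx]

theorem congr (h : SpliceComputable q E F) (hE : ridgeSum E = ridgeSum E')
    (hF : ridgeSum F = ridgeSum F') : SpliceComputable q E' F' := by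
  unfold SpliceComputable at *
  rwa [← hE, ← hF]

theorem self {e : ℝ × ℝ} (he : 0 ≤ e) : SpliceComputable q {e} {e} := by
  unfold SpliceComputable
  simpa [ridgeSum] using (ReLUplus.planeDot he).act.deepen

theorem zero : SpliceComputable q 0 0 := by
  refine (self (q := q) (le_refl (0 : ℝ × ℝ))).congr ?_ ?_ <;>
  · funext z
    simp [ridgeSum, planeDot, relu]

end SpliceComputable

theorem ridgeSum_erase_zero {E : Multiset (ℝ × ℝ)} (h : (0 : ℝ × ℝ) ∈ E) :
    ridgeSum (E.erase 0) = ridgeSum E := by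
  funext z
  conv_rhs => rw [← Multiset.cons_erase h]
  simp [planeDot, relu]

theorem ridgeSum_cons_smul {c : ℝ} (h0 : 0 ≤ c) (h1 : c ≤ 1) (e : ℝ × ℝ)
    (E : Multiset (ℝ × ℝ)) :
    ridgeSum (c • e ::ₘ (1 - c) • e ::ₘ E) = ridgeSum (e ::ₘ E) := by
  funext z
  simp only [ridgeSum_cons, planeDot_smul, relu_mul h0, relu_mul (sub_nonneg.2 h1)]
  ring

theorem spliceComputable_of_split {q : ℝ × ℝ → Prop} {E F : Multiset (ℝ × ℝ)} {e f g : ℝ × ℝ}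
    {t a b : ℝ} (ht : t ∈ Set.Icc (0 : ℝ) 1) (ha : a ∈ Set.Icc (0 : ℝ) 1)
    (hb : b ∈ Set.Icc (0 : ℝ) 1)
    (h : SpliceComputable q {t • e} {a • f, b • g})
    (h' : SpliceComputable q ((1 - t) • e ::ₘ E) ((1 - a) • f ::ₘ (1 - b) • g ::ₘ F)) :
    SpliceComputable q (e ::ₘ E) (f ::ₘ g ::ₘ F) := by
  refine (h.add h').congr ?_ ?_
  · rw [← ridgeSum_cons_smul ht.1 ht.2, Multiset.singleton_add]
  · funext z
    rw [ridgeSum_cons, ← ridgeSum_cons_smul hb.1 hb.2]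
    have := congrFun (ridgeSum_cons_smul ha.1 ha.2 f 0) z
    simp only [ridgeSum_cons, ridgeSum_add, ridgeSum_zero, Multiset.insert_eq_cons,
      ← Multiset.cons_zero] at this ⊢
    linarith

theorem planeDot_sum_neg {F : Multiset (ℝ × ℝ)} {z : ℝ × ℝ} (hF : F ≠ 0)
    (h : ∀ f ∈ F, planeDot f z < 0) : planeDot F.sum z < 0 := by
  have hneg : ∀ G : Multiset (ℝ × ℝ), (∀ f ∈ G, planeDot f z < 0) → planeDot G.sum z ≤ 0 := by
    intro G hG
    have := ridgeSum_eq_planeDot_sum (E := G) (z := -z) fun f hf => by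
      have := hG f hf
      simp only [planeDot, Prod.fst_neg, Prod.snd_neg] at this ⊢
      linarith
    have h0 := ridgeSum_nonneg G (-z)
    simp only [planeDot, Prod.fst_neg, Prod.snd_neg] at this ⊢
    linarith
  obtain ⟨f, hf⟩ := Multiset.exists_mem_of_ne_zero hF
  obtain ⟨G, rfl⟩ := Multiset.exists_cons_of_mem hf
  rw [Multiset.sum_cons, planeDot_add]
  have h1 := h f (Multiset.mem_cons_self f G)
  have h2 := hneg G fun f' hf' => h f' (Multiset.mem_cons_of_mem hf')
  linarith

theorem spliceComputable_of_parallel {q : ℝ × ℝ → Prop} {E F : Multiset (ℝ × ℝ)} {e f : ℝ × ℝ}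
    (hE : ∀ v ∈ e ::ₘ E, 0 ≤ v) (hF : ∀ v ∈ f ::ₘ F, 0 ≤ v) (he0 : e ≠ 0) (hf0 : f ≠ 0)
    (hs : (e ::ₘ E).sum = (f ::ₘ F).sum) (hpar : e.1 * f.2 = e.2 * f.1)
    (ih : ∀ E' F' : Multiset (ℝ × ℝ), (∀ v ∈ E', 0 ≤ v) → (∀ v ∈ F', 0 ≤ v) →
      E'.sum = F'.sum → (0 ∈ E' ∨ 0 ∈ F') →
      E'.card + F'.card ≤ (e ::ₘ E).card + (f ::ₘ F).card → SpliceComputable q E' F') :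
    SpliceComputable q (e ::ₘ E) (f ::ₘ F) := by
  have pos : ∀ v : ℝ × ℝ, 0 ≤ v → v ≠ 0 → 0 < v.1 + v.2 := by
    intro v hv hv0
    refine (add_nonneg hv.1 hv.2).lt_of_ne' fun h => hv0 ?_
    have h1 : 0 ≤ v.1 := hv.1
    have h2 : 0 ≤ v.2 := hv.2
    exact Prod.ext (by simp only [Prod.fst_zero]; linarith) (by simp only [Prod.snd_zero]; linarith)
  have he := hE e (Multiset.mem_cons_self e E)
  have hf := hF f (Multiset.mem_cons_self f F)
  have hpe := pos e he he0
  have hpf := pos f hf hf0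
  obtain ⟨t, a, ht, ha, hta, h1⟩ : ∃ t a : ℝ, t ∈ Set.Icc (0 : ℝ) 1 ∧ a ∈ Set.Icc (0 : ℝ) 1 ∧
      t • e = a • f ∧ (t = 1 ∨ a = 1) := by
    set m := max (e.1 + e.2) (f.1 + f.2) with hm
    have hm0 : 0 < m := lt_max_of_lt_left hpe
    refine ⟨(f.1 + f.2) / m, (e.1 + e.2) / m, ⟨by positivity, ?_⟩, ⟨by positivity, ?_⟩, ?_, ?_⟩
    · exact (div_le_one hm0).2 (le_max_right _ _)
    · exact (div_le_one hm0).2 (le_max_left _ _)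
    · refine Prod.ext ?_ ?_ <;> simp only [Prod.smul_fst, Prod.smul_snd, smul_eq_mul] <;>
        field_simp <;> linarith
    · rcases le_total (e.1 + e.2) (f.1 + f.2) with h | h
      · left; rw [hm, max_eq_right h]; exact div_self hpf.ne'
      · right; rw [hm, max_eq_left h]; exact div_self hpe.ne'
  have hrest : SpliceComputable q ((1 - t) • e ::ₘ E) ((1 - a) • f ::ₘ F) := by
    refine ih _ _ ?_ ?_ ?_ ?_ (by simp)
    · intro v hv
      rcases Multiset.mem_cons.1 hv with rfl | hv
      · exact smul_nonneg (sub_nonneg.2 ht.2) he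
      · exact hE v (Multiset.mem_cons_of_mem hv)
    · intro v hv
      rcases Multiset.mem_cons.1 hv with rfl | hv
      · exact smul_nonneg (sub_nonneg.2 ha.2) hf
      · exact hF v (Multiset.mem_cons_of_mem hv)
    · simp only [Multiset.sum_cons, sub_smul, one_smul] at hs ⊢
      rw [hta, sub_add_eq_add_sub, sub_add_eq_add_sub, hs]
    · rcases h1 with rfl | rfl <;> simp
  refine ((SpliceComputable.self (q := q) (smul_nonneg ht.1 he)).add hrest).congr ?_ ?_
  · rw [Multiset.singleton_add, ridgeSum_cons_smul ht.1 ht.2]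
  · rw [hta, Multiset.singleton_add, ridgeSum_cons_smul ha.1 ha.2]

theorem spliceComputable_of_between {q : ℝ × ℝ → Prop}
    (hq : ∀ e e' : ℝ × ℝ, 0 ≤ e → 0 ≤ e' → SpliceComputable q {e + e'} {e, e'})
    {E F : Multiset (ℝ × ℝ)} {e f g : ℝ × ℝ}
    (hE : ∀ v ∈ e ::ₘ E, 0 ≤ v) (hF : ∀ v ∈ f ::ₘ g ::ₘ F, 0 ≤ v)
    (hs : (e ::ₘ E).sum = (f ::ₘ g ::ₘ F).sum)
    (hef : e.1 * f.2 < e.2 * f.1) (heg : e.2 * g.1 < e.1 * g.2)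
    (ih : ∀ E' F' : Multiset (ℝ × ℝ), (∀ v ∈ E', 0 ≤ v) → (∀ v ∈ F', 0 ≤ v) →
      E'.sum = F'.sum → (0 ∈ E' ∨ 0 ∈ F') →
      E'.card + F'.card ≤ (e ::ₘ E).card + (f ::ₘ g ::ₘ F).card → SpliceComputable q E' F') :
    SpliceComputable q (e ::ₘ E) (f ::ₘ g ::ₘ F) := by
  have he := hE e (by simp)
  have hf := hF f (by simp)
  have hg := hF g (by simp)
  obtain ⟨t, a, b, ht, ha, hb, hab, h1⟩ : ∃ t a b : ℝ, t ∈ Set.Icc (0 : ℝ) 1 ∧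
      a ∈ Set.Icc (0 : ℝ) 1 ∧ b ∈ Set.Icc (0 : ℝ) 1 ∧
      t • e = a • f + b • g ∧ (t = 1 ∨ a = 1 ∨ b = 1) := by
    have he1 : 0 ≤ e.1 := he.1
    have he2 : 0 ≤ e.2 := he.2
    have hf1 : 0 ≤ f.1 := hf.1
    have hf2 : 0 ≤ f.2 := hf.2
    have hg1 : 0 ≤ g.1 := hg.1
    have hg2 : 0 ≤ g.2 := hg.2
    have hb0 : 0 < e.2 := by
      by_contra! h
      nlinarith [mul_nonneg he1 hf2, mul_nonneg (sub_nonneg.2 h) hf1]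
    have hgp : 0 < g.2 := by
      by_contra! h
      nlinarith [mul_nonneg he2 hg1, mul_nonneg (sub_nonneg.2 h) he1]
    have hD : 0 < f.1 * g.2 - f.2 * g.1 := by
      refine pos_of_mul_pos_right (a := e.2) ?_ hb0.le
      nlinarith [mul_pos hgp (sub_pos.2 hef), mul_nonneg hf2 (sub_nonneg.2 heg.le)]
    set D := f.1 * g.2 - f.2 * g.1 with hDdef
    set A := e.1 * g.2 - e.2 * g.1 with hA
    set B := e.2 * f.1 - e.1 * f.2 with hB
    have hA0 : 0 < A := sub_pos.2 heg
    have hB0 : 0 < B := sub_pos.2 hef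
    set m := max D (max A B) with hm
    have hm0 : 0 < m := lt_max_of_lt_left hD
    refine ⟨D / m, A / m, B / m, ⟨by positivity, ?_⟩, ⟨by positivity, ?_⟩, ⟨by positivity, ?_⟩,
      ?_, ?_⟩
    · exact (div_le_one hm0).2 (le_max_left _ _)
    · exact (div_le_one hm0).2 (le_max_of_le_right (le_max_left _ _))
    · exact (div_le_one hm0).2 (le_max_of_le_right (le_max_right _ _))
    · refine Prod.ext ?_ ?_ <;>
        simp only [Prod.smul_fst, Prod.smul_snd, Prod.fst_add, Prod.snd_add, smul_eq_mul] <;>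
        field_simp <;> rw [hDdef, hA, hB] <;> ring
    · simp only [div_eq_one_iff_eq hm0.ne']
      rcases max_choice D (max A B) with h | h
      · exact Or.inl (hm.trans h).symm
      · rcases max_choice A B with h' | h'
        · exact Or.inr (Or.inl ((hm.trans h).trans h').symm)
        · exact Or.inr (Or.inr ((hm.trans h).trans h').symm)
  refine spliceComputable_of_split ht ha hb
    (hab ▸ hq _ _ (smul_nonneg ha.1 hf) (smul_nonneg hb.1 hg)) (ih _ _ ?_ ?_ ?_ ?_ (by simp))
  · intro v hv
    rcases Multiset.mem_cons.1 hv with rfl | hv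
    · exact smul_nonneg (sub_nonneg.2 ht.2) he
    · exact hE v (Multiset.mem_cons_of_mem hv)
  · intro v hv
    rcases Multiset.mem_cons.1 hv with rfl | hv
    · exact smul_nonneg (sub_nonneg.2 ha.2) hf
    · rcases Multiset.mem_cons.1 hv with rfl | hv
      · exact smul_nonneg (sub_nonneg.2 hb.2) hg
      · exact hF v (Multiset.mem_cons_of_mem (Multiset.mem_cons_of_mem hv))
  · simp only [Multiset.sum_cons, sub_smul, one_smul] at hs ⊢
    rw [hab, sub_add_eq_add_sub, hs]
    abel
  · rcases h1 with rfl | rfl | rfl <;> simp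

theorem spliceComputable_of_lowest {q : ℝ × ℝ → Prop}
    (hq : ∀ e e' : ℝ × ℝ, 0 ≤ e → 0 ≤ e' → SpliceComputable q {e + e'} {e, e'})
    {E F : Multiset (ℝ × ℝ)} (hE : ∀ v ∈ E, 0 ≤ v) (hF : ∀ v ∈ F, 0 ≤ v)
    (hE0 : (0 : ℝ × ℝ) ∉ E) (hF0 : (0 : ℝ × ℝ) ∉ F) (hs : E.sum = F.sum)
    {e f : ℝ × ℝ} (he : e ∈ E) (hf : f ∈ F) (hlow : ∀ v ∈ E, e.2 * v.1 ≤ e.1 * v.2)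
    (hef : e.1 * f.2 ≤ e.2 * f.1)
    (ih : ∀ E' F' : Multiset (ℝ × ℝ), (∀ v ∈ E', 0 ≤ v) → (∀ v ∈ F', 0 ≤ v) →
      E'.sum = F'.sum → (0 ∈ E' ∨ 0 ∈ F') →
      E'.card + F'.card ≤ E.card + F.card → SpliceComputable q E' F') :
    SpliceComputable q E F := by
  obtain ⟨g, hg, heg⟩ : ∃ g ∈ F, e.2 * g.1 ≤ e.1 * g.2 := by
    by_contra! hcon
    have h1 : planeDot F.sum (-e.2, e.1) < 0 :=
      planeDot_sum_neg (fun h => by simp [h] at hf) fun v hv => by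
        have := hcon v hv
        simp only [planeDot]; linarith
    have h2 := ridgeSum_eq_planeDot_sum (E := E) (z := (-e.2, e.1)) fun v hv => by
      have := hlow v hv
      simp only [planeDot]; linarith
    have h3 := ridgeSum_nonneg E (-e.2, e.1)
    rw [h2, hs] at h3
    linarith
  have ne : ∀ v ∈ F, v ≠ 0 := fun v hv h => hF0 (h ▸ hv)
  have he0 : e ≠ 0 := fun h => hE0 (h ▸ he)
  obtain ⟨E, rfl⟩ := Multiset.exists_cons_of_mem he
  rcases hef.eq_or_lt with h1 | h1
  · obtain ⟨F, rfl⟩ := Multiset.exists_cons_of_mem hf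
    exact spliceComputable_of_parallel hE hF he0 (ne f hf) hs h1 ih
  rcases heg.eq_or_lt with h2 | h2
  · obtain ⟨F, rfl⟩ := Multiset.exists_cons_of_mem hg
    exact spliceComputable_of_parallel hE hF he0 (ne g hg) hs h2.symm ih
  obtain ⟨F, rfl⟩ := Multiset.exists_cons_of_mem hf
  rcases Multiset.mem_cons.1 hg with rfl | hg
  · exact absurd h1 h2.not_gt
  obtain ⟨F, rfl⟩ := Multiset.exists_cons_of_mem hg
  exact spliceComputable_of_between hq hE hF hs h1 h2 ih

/-- Minkowski decomposition of a polygon into segments and triangles, phrased for the support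
function of the polygon whose two boundary chains have edges `E` and `F`. -/
theorem spliceComputable_of_triangles {q : ℝ × ℝ → Prop}
    (hq : ∀ e e' : ℝ × ℝ, 0 ≤ e → 0 ≤ e' → SpliceComputable q {e + e'} {e, e'})
    (hq' : ∀ e e' : ℝ × ℝ, 0 ≤ e → 0 ≤ e' → SpliceComputable q {e, e'} {e + e'})
    {E F : Multiset (ℝ × ℝ)} (hE : ∀ v ∈ E, 0 ≤ v) (hF : ∀ v ∈ F, 0 ≤ v)
    (hs : E.sum = F.sum) : SpliceComputable q E F := by
  induction hn : E.card + F.card using Nat.strong_induction_on generalizing E F with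
  | _ n ih =>
    subst hn
    have ih' : ∀ E' F' : Multiset (ℝ × ℝ), (∀ v ∈ E', 0 ≤ v) → (∀ v ∈ F', 0 ≤ v) →
        E'.sum = F'.sum → (0 ∈ E' ∨ 0 ∈ F') →
        E'.card + F'.card ≤ E.card + F.card → SpliceComputable q E' F' := by
      intro E' F' hE' hF' hs' h0 hc
      rcases h0 with h0 | h0
      · have h1 := Multiset.card_erase_lt_of_mem h0
        refine (ih _ (by omega) (fun v hv => hE' v (Multiset.mem_of_mem_erase hv)) hF' ?_
          rfl).congr (ridgeSum_erase_zero h0) rfl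
        rw [← hs', ← Multiset.sum_erase h0, zero_add]
      · have h1 := Multiset.card_erase_lt_of_mem h0
        refine (ih _ (by omega) hE' (fun v hv => hF' v (Multiset.mem_of_mem_erase hv)) ?_
          rfl).congr rfl (ridgeSum_erase_zero h0)
        rw [hs', ← Multiset.sum_erase h0, zero_add]
    by_cases h0 : (0 : ℝ × ℝ) ∈ E ∨ (0 : ℝ × ℝ) ∈ F
    · exact ih' E F hE hF hs h0 le_rfl
    push Not at h0
    have hempty : ∀ G : Multiset (ℝ × ℝ), (∀ v ∈ G, 0 ≤ v) → (0 : ℝ × ℝ) ∉ G → G.sum = 0 →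
        G = 0 := fun G hG hG0 hGs => Multiset.eq_zero_of_forall_notMem fun v hv =>
      hG0 (Multiset.all_zero_of_le_zero_le_of_sum_eq_zero hG hGs v hv ▸ hv)
    by_cases hE0 : E = 0
    · subst hE0
      rw [hempty F hF h0.2 (by simpa using hs.symm)]
      exact SpliceComputable.zero
    by_cases hF0 : F = 0
    · subst hF0
      rw [hempty E hE h0.1 (by simpa using hs)]
      exact SpliceComputable.zero
    obtain ⟨e, he, hemin⟩ := Multiset.exists_min_image steepness hE0
    obtain ⟨f, hf, hfmin⟩ := Multiset.exists_min_image steepness hF0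
    rcases le_total (e.1 * f.2) (e.2 * f.1) with h | h
    · exact spliceComputable_of_lowest hq hE hF h0.1 h0.2 hs he hf
        (fun v hv => cross_le_of_steepness_le (hE e he) (hE v hv) (hemin v hv)) h ih'
    · refine SpliceComputable.of_not (spliceComputable_of_lowest
        (fun a b ha hb => (hq' a b ha hb).symm) hF hE h0.2 h0.1 hs.symm hf he
        (fun v hv => cross_le_of_steepness_le (hF f hf) (hF v hv) (hfmin v hv)) (by linarith) ?_)
      intro F' E' hF' hE' hs' h0' hc
      exact (ih' E' F' hE' hF' hs'.symm h0'.symm (by omega)).symm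

theorem spliceComputable_halfPlane {E F : Multiset (ℝ × ℝ)} (hE : ∀ v ∈ E, 0 ≤ v)
    (hF : ∀ v ∈ F, 0 ≤ v) (hs : E.sum = F.sum) :
    SpliceComputable (fun z => z.1 ≤ 0) E F := by
  refine spliceComputable_of_triangles ?_ ?_ hE hF hs
  · have key : ∀ e e' : ℝ × ℝ, 0 ≤ e → 0 ≤ e' → e'.2 * e.1 ≤ e'.1 * e.2 →
        SpliceComputable (fun z => z.1 ≤ 0) {e + e'} {e, e'} := by
      intro e e' he he' h
      unfold SpliceComputable
      convert ReLUplus.relu_planeDot_add_relu he' he using 2 with x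
      rw [relu_add_relu_of_shallower he he' h]
      simp [ridgeSum]
    intro e e' he he'
    rcases le_total (e'.2 * e.1) (e'.1 * e.2) with h | h
    · exact key e e' he he' h
    · rw [add_comm, Multiset.pair_comm]
      exact key e' e he' he (by linarith)
  · have key : ∀ e e' : ℝ × ℝ, 0 ≤ e → 0 ≤ e' → e'.2 * e.1 ≤ e'.1 * e.2 →
        SpliceComputable (fun z => z.1 ≤ 0) {e, e'} {e + e'} := by
      intro e e' he he' h
      unfold SpliceComputable
      convert ReLUplus.relu_planeDot_add_relu he he' using 2 with x
      rw [relu_add_relu_of_steeper he he' h]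
      simp [ridgeSum]
    intro e e' he he'
    rcases le_total (e'.2 * e.1) (e'.1 * e.2) with h | h
    · exact key e e' he he' h
    · rw [add_comm, Multiset.pair_comm]
      exact key e' e he' he (by linarith)

/-- A homogeneous convex CPWL function is the maximum of finitely many linear functions. -/
theorem exists_finset_linear_of_isCPWL {n : ℕ} {F : (Fin n → ℝ) → ℝ} (hcpwl : IsCPWL F)
    (hhom : ∀ a : ℝ, 0 ≤ a → ∀ x : Fin n → ℝ, F (a • x) = a * F x)
    (hconv : ConvexOn ℝ Set.univ F) :
    ∃ V : Finset (Fin n → ℝ), (∀ p ∈ V, ∀ y, ∑ i, p i * y i ≤ F y) ∧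
      ∀ x, ∃ p ∈ V, F x = ∑ i, p i * x i := by
  classical
  obtain ⟨hcont, s, hs⟩ := hcpwl
  have hlin : ∀ p : Fin n → ℝ, Continuous fun y : Fin n → ℝ => ∑ i, p i * y i := fun p => by
    fun_prop
  set V := (s.image Prod.fst).filter fun p => ∀ y, ∑ i, p i * y i ≤ F y with hV
  refine ⟨V, fun p hp => (Finset.mem_filter.1 hp).2, ?_⟩
  let A : s → Set (Fin n → ℝ) := fun p => {x | F x = (∑ i, p.1.1 i * x i) + p.1.2}
  have hdense : Dense (⋃ p, interior (A p)) := by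
    refine dense_iUnion_interior_of_closed
      (fun p => isClosed_eq hcont ((hlin _).add continuous_const)) ?_
    refine Set.eq_univ_of_forall fun x => ?_
    obtain ⟨p, hp, hx⟩ := hs x
    exact Set.mem_iUnion.2 ⟨⟨p, hp⟩, hx⟩
  have hsub : (⋃ p, interior (A p)) ⊆ {x | ∃ p ∈ V, F x = ∑ i, p i * x i} := by
    intro x hx
    obtain ⟨⟨⟨p, b⟩, hp⟩, hx⟩ := Set.mem_iUnion.1 hx
    have hxA : F x = (∑ i, p i * x i) + b :=
      (interior_subset hx : x ∈ A ⟨(p, b), hp⟩)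
    have hlc : ConcaveOn ℝ Set.univ fun y : Fin n → ℝ => ∑ i, p i * y i := by
      refine ⟨convex_univ, fun y _ z _ a c _ _ _ => le_of_eq ?_⟩
      simp only [smul_eq_mul, Finset.mul_sum, ← Finset.sum_add_distrib, Pi.add_apply,
        Pi.smul_apply]
      exact Finset.sum_congr rfl fun i _ => by ring
    have hmin : ∀ y, b ≤ F y - ∑ i, p i * y i := by
      have hloc : IsLocalMin (fun y => F y - ∑ i, p i * y i) x := by
        filter_upwards [mem_interior_iff_mem_nhds.1 hx] with y hy
        have hy' : F y = (∑ i, p i * y i) + b := hy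
        rw [hxA, hy']; linarith
      intro y
      have := IsMinOn.of_isLocalMin_of_convex_univ hloc (hconv.sub hlc) y
      linarith
    have hF0 : F 0 = 0 := by simpa using hhom 0 le_rfl 0
    have hb : b ≤ 0 := by simpa [hF0] using hmin 0
    have hle : ∀ y, ∑ i, p i * y i ≤ F y := by
      intro y
      by_contra! hlt
      obtain ⟨N, hN⟩ := exists_nat_gt (-b / (∑ i, p i * y i - F y))
      rw [div_lt_iff₀ (sub_pos.2 hlt)] at hN
      have := hmin ((N : ℝ) • y)
      rw [hhom _ N.cast_nonneg] at this
      have h2 : ∑ i, p i * ((N : ℝ) • y) i = N * ∑ i, p i * y i := by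
        rw [Finset.mul_sum]
        exact Finset.sum_congr rfl fun i _ => by simp only [Pi.smul_apply, smul_eq_mul]; ring
      rw [h2] at this
      nlinarith
    refine ⟨p, Finset.mem_filter.2 ⟨Finset.mem_image_of_mem Prod.fst hp, hle⟩, ?_⟩
    have := hle x
    linarith
  have hclosed : IsClosed {x | ∃ p ∈ V, F x = ∑ i, p i * x i} := by
    have : {x | ∃ p ∈ V, F x = ∑ i, p i * x i} = ⋃ p ∈ V, {x | F x = ∑ i, p i * x i} := by
      ext x; simp
    rw [this]
    exact V.finite_toSet.isClosed_biUnion fun p _ => isClosed_eq hcont (hlin p)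
  intro x
  exact hclosed.closure_subset_iff.2 hsub (hdense x)

theorem mem_subgrad_iff_of_homogeneous {n : ℕ} {F : (Fin n → ℝ) → ℝ}
    (hhom : ∀ a : ℝ, 0 ≤ a → ∀ x : Fin n → ℝ, F (a • x) = a * F x) {g x : Fin n → ℝ} :
    g ∈ subgrad F x ↔ (∀ y, ∑ i, g i * y i ≤ F y) ∧ F x = ∑ i, g i * x i := by
  have hsub : ∀ y : Fin n → ℝ, ∑ i, g i * (y i - x i) = ∑ i, g i * y i - ∑ i, g i * x i := fun y => by
    simp only [mul_sub, Finset.sum_sub_distrib]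
  constructor
  · intro h
    have hx : F x = ∑ i, g i * x i := by
      have h0 := h 0
      have h2 := h ((2 : ℝ) • x)
      have hF0 : F 0 = 0 := by simpa using hhom 0 le_rfl 0
      have hsm : ∑ i, g i * ((2 : ℝ) • x) i = 2 * ∑ i, g i * x i := by
        rw [Finset.mul_sum]
        exact Finset.sum_congr rfl fun i _ => by simp only [Pi.smul_apply, smul_eq_mul]; ring
      rw [hsub, hF0] at h0
      rw [hsub, hhom 2 zero_le_two, hsm] at h2
      simp only [Pi.zero_apply, mul_zero, Finset.sum_const_zero] at h0
      linarith
    refine ⟨fun y => ?_, hx⟩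
    have := h y
    rw [hsub] at this
    linarith
  · rintro ⟨h, hx⟩ y
    rw [hsub, hx]
    linarith [h y]

/-- Along the second quadrant, the support function of a finite set with a least and a greatest
element describes a chain of edges joining these two. -/
theorem exists_edges_of_isGreatest {H : ℝ × ℝ → ℝ} {V : Finset (ℝ × ℝ)}
    (hV : ∀ z, IsGreatest ((fun p => planeDot p z) '' (V : Set (ℝ × ℝ))) (H z))
    {A B : ℝ × ℝ} (hlo : ∀ p ∈ V, B ≤ p) (hhi : ∀ p ∈ V, p ≤ A)
    (hB : H (-1, 0) = -B.1) (hA : H (0, 1) = A.2) :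
    ∃ E : Multiset (ℝ × ℝ), (∀ e ∈ E, 0 ≤ e) ∧ E.sum = A - B ∧
      ∀ z : ℝ × ℝ, z.1 ≤ 0 → 0 ≤ z.2 → H z = planeDot B z + ridgeSum E z := by
  have hne : V.Nonempty := by
    obtain ⟨p, hp, -⟩ := (hV 0).1
    exact ⟨p, hp⟩
  obtain ⟨w, hw, E, hE, hu, hg⟩ := exists_isGreatest_ridgeSum V hne
  have hH : ∀ z : ℝ × ℝ, z.1 ≤ 0 → 0 ≤ z.2 → H z = planeDot w z + ridgeSum E z :=
    fun z h1 h2 => (hV z).unique (hg z h1 h2)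
  have hw1 : w.1 = B.1 := by
    have h := hH (-1, 0) (by norm_num) le_rfl
    have h0 : ridgeSum E (-1, 0) = 0 := ridgeSum_eq_zero fun e he =>
      planeDot_nonpos (hE e he) ⟨by norm_num, le_rfl⟩
    rw [hB, h0] at h
    simp only [planeDot] at h
    linarith
  have hu2 : (w + E.sum).2 = A.2 := by
    have h := hH (0, 1) le_rfl zero_le_one
    have h0 : ridgeSum E (0, 1) = planeDot E.sum (0, 1) := ridgeSum_eq_planeDot_sum fun e he =>
      planeDot_nonneg (hE e he) ⟨le_rfl, zero_le_one' ℝ⟩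
    rw [hA, h0] at h
    simp only [planeDot] at h
    simp only [Prod.snd_add]
    linarith
  refine ⟨(w - B) ::ₘ (A - (w + E.sum)) ::ₘ E, ?_, ?_, fun z h1 h2 => ?_⟩
  · intro e he
    rcases Multiset.mem_cons.1 he with rfl | he
    · exact sub_nonneg.2 (hlo w hw)
    rcases Multiset.mem_cons.1 he with rfl | he
    · exact sub_nonneg.2 (hhi _ hu)
    · exact hE e he
  · simp only [Multiset.sum_cons]
    abel
  · have hw2 : B.2 ≤ w.2 := (hlo w hw).2
    have hu1 : (w + E.sum).1 ≤ A.1 := (hhi _ hu).1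
    have h3 : 0 ≤ planeDot (w - B) z := by
      simp only [planeDot, Prod.fst_sub, Prod.snd_sub, hw1]
      nlinarith
    have h4 : planeDot (A - (w + E.sum)) z ≤ 0 := by
      simp only [planeDot, Prod.fst_sub, Prod.snd_sub, hu2]
      nlinarith
    rw [hH z h1 h2, ridgeSum_cons, ridgeSum_cons, relu_of_nonneg h3, relu_of_nonpos h4,
      planeDot_sub]
    ring

theorem planeDot_swap (w z : ℝ × ℝ) : planeDot w.swap z.swap = planeDot w z :=
  add_comm _ _

theorem ridgeSum_map_swap (E : Multiset (ℝ × ℝ)) (z : ℝ × ℝ) :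
    ridgeSum (E.map Prod.swap) z.swap = ridgeSum E z := by
  simp only [ridgeSum, Multiset.map_map, Function.comp_def, planeDot_swap]

/-- The mirror image of `exists_edges_of_isGreatest`, along the fourth quadrant. -/
theorem exists_edges_of_isGreatest' {H : ℝ × ℝ → ℝ} {V : Finset (ℝ × ℝ)}
    (hV : ∀ z, IsGreatest ((fun p => planeDot p z) '' (V : Set (ℝ × ℝ))) (H z))
    {A B : ℝ × ℝ} (hlo : ∀ p ∈ V, B ≤ p) (hhi : ∀ p ∈ V, p ≤ A)
    (hB : H (0, -1) = -B.2) (hA : H (1, 0) = A.1) :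
    ∃ E : Multiset (ℝ × ℝ), (∀ e ∈ E, 0 ≤ e) ∧ E.sum = A - B ∧
      ∀ z : ℝ × ℝ, 0 ≤ z.1 → z.2 ≤ 0 → H z = planeDot B z + ridgeSum E z := by
  classical
  obtain ⟨E, hE, hs, hr⟩ := exists_edges_of_isGreatest (H := fun z => H z.swap)
    (V := V.image Prod.swap) (A := A.swap) (B := B.swap) (fun z => by
      have := hV z.swap
      rw [Finset.coe_image, Set.image_image]
      have key : (fun p : ℝ × ℝ => planeDot p.swap z) = fun p => planeDot p z.swap :=
        funext fun p => planeDot_swap p z.swap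
      rwa [key])
    (by
      intro p hp
      obtain ⟨v, hv, rfl⟩ := Finset.mem_image.1 hp
      exact ⟨(hlo v hv).2, (hlo v hv).1⟩)
    (by
      intro p hp
      obtain ⟨v, hv, rfl⟩ := Finset.mem_image.1 hp
      exact ⟨(hhi v hv).2, (hhi v hv).1⟩) hB hA
  refine ⟨E.map Prod.swap, ?_, ?_, fun z h1 h2 => ?_⟩
  · intro e he
    obtain ⟨v, hv, rfl⟩ := Multiset.mem_map.1 he
    exact ⟨(hE v hv).2, (hE v hv).1⟩
  · have h := (AddEquiv.prodComm (M := ℝ) (N := ℝ)).toAddMonoidHom.map_multiset_sum E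
    have h' : (E.map Prod.swap).sum = E.sum.swap := h.symm
    rw [h', hs]
    rfl
  · have h : H z = planeDot B.swap z.swap + ridgeSum E z.swap := hr z.swap h2 h1
    rw [h, planeDot_swap, ← ridgeSum_map_swap E z.swap, Prod.swap_swap]

/-- Every CPWL, (positively) homogeneous, monotone, convex function on `ℝ²`
with isotonic subgradient is computable by a depth-2 monotone ReLU network. -/
theorem plane_isotonic_in_ReLUplus_two {F : (Fin 2 → ℝ) → ℝ}
    (hcpwl : IsCPWL F)
    (hhom : ∀ a : ℝ, 0 ≤ a → ∀ x : Fin 2 → ℝ, F (a • x) = a * F x)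
    (hmono : Monotone F)
    (hconv : ConvexOn ℝ Set.univ F)
    (hiso : IsotonicSubgrad F) :
    ReLUplus 2 2 F := by
  classical
  have hF0 : F 0 = 0 := by simpa using hhom 0 le_rfl 0
  obtain ⟨V, hVle, hVex⟩ := exists_finset_linear_of_isCPWL hcpwl hhom hconv
  have hmem : ∀ {g x : Fin 2 → ℝ}, g ∈ subgrad F x ↔
      (∀ y, g 0 * y 0 + g 1 * y 1 ≤ F y) ∧ F x = g 0 * x 0 + g 1 * x 1 := fun {g x} => by
    rw [mem_subgrad_iff_of_homogeneous hhom]; simp only [Fin.sum_univ_two]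
  simp only [Fin.sum_univ_two] at hVle hVex
  have hsup : ∀ x, ∃ p ∈ subgrad F 0, F x = p 0 * x 0 + p 1 * x 1 := fun x => by
    obtain ⟨p, hp, hx⟩ := hVex x
    exact ⟨p, hmem.2 ⟨hVle p hp, by simp [hF0]⟩, hx⟩
  set A : ℝ × ℝ := (F ![1, 0], F ![0, 1]) with hA
  set B : ℝ × ℝ := (-F ![-1, 0], -F ![0, -1]) with hB
  have bounds : ∀ p : Fin 2 → ℝ, (∀ y, p 0 * y 0 + p 1 * y 1 ≤ F y) →
      B ≤ (p 0, p 1) ∧ (p 0, p 1) ≤ A := by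
    intro p hp
    have h1 := hp ![1, 0]
    have h2 := hp ![0, 1]
    have h3 := hp ![-1, 0]
    have h4 := hp ![0, -1]
    simp only [Matrix.cons_val_zero, Matrix.cons_val_one] at h1 h2 h3 h4
    refine ⟨⟨?_, ?_⟩, ?_, ?_⟩ <;> simp only [hA, hB] <;> linarith
  have hAF : ∀ y, A.1 * y 0 + A.2 * y 1 ≤ F y := by
    obtain ⟨p, hp, hp1⟩ := hsup ![0, 1]
    obtain ⟨b, hb, hpb⟩ := (hiso 0 ![1, 0] (by intro i; fin_cases i <;> simp)).1 p hp
    obtain ⟨hb1, hb2⟩ := hmem.1 hb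
    have h1 : p 1 ≤ b 1 := hpb 1
    have h2 : b 1 ≤ A.2 := (bounds b hb1).2.2
    simp only [Matrix.cons_val_zero, Matrix.cons_val_one] at hp1 hb2
    have h3 : A.1 = b 0 := by simp only [hA]; linarith
    have h4 : A.2 = b 1 := le_antisymm (by simp only [hA]; linarith) h2
    rw [h3, h4]
    exact hb1
  have hBF : ∀ y, B.1 * y 0 + B.2 * y 1 ≤ F y := by
    obtain ⟨p, hp, hp1⟩ := hsup ![0, -1]
    obtain ⟨b, hb, hpb⟩ := (hiso ![-1, 0] 0 (by intro i; fin_cases i <;> simp)).2 p hp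
    obtain ⟨hb1, hb2⟩ := hmem.1 hb
    have h1 : b 1 ≤ p 1 := hpb 1
    have h2 : B.2 ≤ b 1 := (bounds b hb1).1.2
    simp only [Matrix.cons_val_zero, Matrix.cons_val_one] at hp1 hb2
    have h3 : B.1 = b 0 := by simp only [hB]; linarith
    have h4 : B.2 = b 1 := le_antisymm h2 (by simp only [hB]; linarith)
    rw [h3, h4]
    exact hb1
  have hB0 : 0 ≤ B := by
    have h1 : F ![-1, 0] ≤ F 0 := hmono (by intro i; fin_cases i <;> simp)
    have h2 : F ![0, -1] ≤ F 0 := hmono (by intro i; fin_cases i <;> simp)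
    rw [hF0] at h1 h2
    exact ⟨neg_nonneg.2 h1, neg_nonneg.2 h2⟩
  have hpos : ∀ x : Fin 2 → ℝ, 0 ≤ x 0 → 0 ≤ x 1 → F x = planeDot A (x 0, x 1) := by
    intro x h0 h1
    obtain ⟨p, hp, hx⟩ := hsup x
    have hpA := (bounds p (hmem.1 hp).1).2
    refine le_antisymm ?_ (hAF x)
    rw [hx]
    exact add_le_add (mul_le_mul_of_nonneg_right hpA.1 h0) (mul_le_mul_of_nonneg_right hpA.2 h1)
  have hneg : ∀ x : Fin 2 → ℝ, x 0 ≤ 0 → x 1 ≤ 0 → F x = planeDot B (x 0, x 1) := by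
    intro x h0 h1
    obtain ⟨p, hp, hx⟩ := hsup x
    have hpB := (bounds p (hmem.1 hp).1).1
    refine le_antisymm ?_ (hBF x)
    rw [hx]
    exact add_le_add (mul_le_mul_of_nonpos_right hpB.1 h0) (mul_le_mul_of_nonpos_right hpB.2 h1)
  have hpair : ∀ x : Fin 2 → ℝ, ![x 0, x 1] = x := fun x => by
    ext i; fin_cases i <;> rfl
  set W : Finset (ℝ × ℝ) := V.image fun p => (p 0, p 1) with hW
  have hgr : ∀ z : ℝ × ℝ,
      IsGreatest ((fun p => planeDot p z) '' (W : Set (ℝ × ℝ))) (F ![z.1, z.2]) := by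
    intro z
    constructor
    · obtain ⟨p, hp, hz⟩ := hVex ![z.1, z.2]
      exact ⟨(p 0, p 1), Finset.mem_image_of_mem _ hp, hz.symm⟩
    · rintro _ ⟨_, hpW, rfl⟩
      obtain ⟨p, hp, rfl⟩ := Finset.mem_image.1 hpW
      exact hVle p hp ![z.1, z.2]
  have hbd : ∀ p ∈ W, B ≤ p ∧ p ≤ A := by
    intro v hv
    obtain ⟨p, hp, rfl⟩ := Finset.mem_image.1 hv
    exact bounds p (hVle p hp)
  obtain ⟨E, hE, hEs, hEF⟩ := exists_edges_of_isGreatest hgr (fun p hp => (hbd p hp).1)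
    (fun p hp => (hbd p hp).2) (by simp [hB]) (by simp [hA])
  obtain ⟨E', hE', hEs', hEF'⟩ := exists_edges_of_isGreatest' hgr (fun p hp => (hbd p hp).1)
    (fun p hp => (hbd p hp).2) (by simp [hB]) (by simp [hA])
  have hnet := (ReLUplus.planeDot hB0).deepen.deepen.add
    (spliceComputable_halfPlane hE hE' (hEs.trans hEs'.symm))
  convert hnet using 2 with x
  split_ifs with h0
  · rcases le_total (x 1) 0 with h1 | h1
    · rw [hneg x h0 h1, ridgeSum_eq_zero fun e he => planeDot_nonpos (hE e he) ⟨h0, h1⟩, add_zero]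
    · rw [← hEF (x 0, x 1) h0 h1, hpair]
  · replace h0 : 0 ≤ x 0 := (not_le.1 h0).le
    rcases le_total (x 1) 0 with h1 | h1
    · rw [← hEF' (x 0, x 1) h0 h1, hpair]
    · rw [hpos x h0 h1, ridgeSum_eq_planeDot_sum fun e he =>
        planeDot_nonneg (hE' e he) ⟨h0, h1⟩, hEs', planeDot_sub]
      ring
end
end

section
/- For every n > 1, the maximum function MAX_n belongs to ICNN_{n,n}; that is, MAX_n is computable by a depth-n input convex neural network. -/
noncomputable section

/-- `ICNN n k F` : `F : ℝⁿ → ℝ` is computable by a depth-`k` input convex neural network. -/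
inductive ICNN (n : ℕ) : ℕ → ((Fin n → ℝ) → ℝ) → Prop
  | affine (a : Fin n → ℝ) (b : ℝ) :
      ICNN n 0 (fun x => (∑ i, a i * x i) + b)
  | comb {k : ℕ} {F G : (Fin n → ℝ) → ℝ} (c c' : ℝ) (a : Fin n → ℝ) (b : ℝ)
      (hc : 0 ≤ c) (hc' : 0 ≤ c') (hF : ICNN n k F) (hG : ICNN n k G) :
      ICNN n k (fun x => c * F x + c' * G x + (∑ i, a i * x i) + b)
  | act {k : ℕ} {F : (Fin n → ℝ) → ℝ} (hF : ICNN n k F) :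
      ICNN n (k + 1) (fun x => relu (F x))
  | deepen {k : ℕ} {F : (Fin n → ℝ) → ℝ} (hF : ICNN n k F) :
      ICNN n (k + 1) F

/-- `MAXn n x = max {x 1, …, x n}` (for `n ≥ 1`, the supremum over the coordinates). -/
def MAXn (n : ℕ) (x : Fin n → ℝ) : ℝ := ⨆ i, x i

theorem iSup_fin_succ_eq_add_relu {k : ℕ} (f : Fin (k + 2) → ℝ) :
    ⨆ j, f j = f 0 + relu (⨆ j : Fin (k + 1), (f j.succ - f 0)) := by
  have hf : BddAbove (Set.range f) := (Set.finite_range f).bddAbove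
  have hg : BddAbove (Set.range fun j : Fin (k + 1) => f j.succ - f 0) :=
    (Set.finite_range _).bddAbove
  unfold relu
  apply le_antisymm
  · refine ciSup_le fun j => ?_
    refine Fin.cases ?_ (fun i => ?_) j
    · exact le_add_of_nonneg_right (le_max_left _ _)
    · have h := (le_ciSup hg i).trans (le_max_right 0 _)
      linarith
  · rw [← le_sub_iff_add_le']
    refine max_le (sub_nonneg.2 (le_ciSup hf 0)) (ciSup_le fun i => ?_)
    exact sub_le_sub_right (le_ciSup hf i.succ) _

/-- The maximum of `k + 1` linear functions is computable in depth `k`. -/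
theorem ICNN.iSup_linear {n : ℕ} : ∀ (k : ℕ) (A : Fin (k + 1) → Fin n → ℝ),
    ICNN n k (fun x => ⨆ j, ∑ i, A j i * x i)
  | 0, A => by
    simpa using ICNN.affine (A 0) 0
  | k + 1, A => by
    have h := (ICNN.iSup_linear k fun j i => A j.succ i - A 0 i).act
    have hc := ICNN.comb 1 0 (A 0) 0 zero_le_one le_rfl h h
    convert hc using 2 with x
    rw [iSup_fin_succ_eq_add_relu]
    simp only [sub_mul, Finset.sum_sub_distrib]
    ring

/-- For every `n > 1`, `MAX_n` is computable by a depth-`n` input convex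
neural network. -/
theorem maxn_in_ICNN : ∀ n : ℕ, 1 < n → ICNN n n (MAXn n) := by
  intro n hn
  obtain ⟨k, rfl⟩ : ∃ k, n = k + 1 := ⟨n - 1, by omega⟩
  convert (ICNN.iSup_linear k (1 : Matrix (Fin (k + 1)) (Fin (k + 1)) ℝ)).deepen using 1
  ext x
  simp [MAXn, Matrix.one_apply]
end
end
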